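/- arXiv:1408.1866 — 7 statements merged into one kernel-verified Lean document; each statement's English description precedes it below -/
import Mathlib

section
/- Let (X, d, μ) be a uniformly rectifiable metric median algebra of rank at most n (for some n ∈ ℕ) such that (X, d) is complete and connected. Let a group G act on X by isometries of (X,d) satisfying g·μ(x₁,x₂,x₃) = μ(g·x₁, g·x₂, g·x₃) for all g ∈ G and x₁,x₂,x₃ ∈ X. If the action has bounded orbits, then it has a fixed point. -/
/-- The axioms of a median algebra for a ternary operation. -/
def IsMedianFn {X : Type*} (μ : X → X → X → X) : Prop :=
  (∀ x y z, μ x y z = μ x z y) ∧ (∀ x y z, μ x y z = μ y z x) ∧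
    (∀ x y, μ x x y = x) ∧
    ∀ x y z u v, μ (μ x y z) u v = μ x (μ y u v) (μ z u v)

/-- A subset closed under the median operation. -/
def IsSubalgebra {X : Type*} (μ : X → X → X → X) (M : Set X) : Prop :=
  ∀ a ∈ M, ∀ b ∈ M, ∀ c ∈ M, μ a b c ∈ M

/-- `h` is convex in the subalgebra `M`: it contains `I(a,b) ∩ M` for all `a, b ∈ h`. -/
def ConvexIn {X : Type*} (μ : X → X → X → X) (M h : Set X) : Prop :=
  ∀ a ∈ h, ∀ b ∈ h, ∀ z ∈ M, μ a b z = z → z ∈ h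

/-- A halfspace of the subalgebra `M`: one side of a wall of `M`, i.e. a nonempty convex
subset of `M` with nonempty convex complement `M \ h`.  Walls of `M` correspond to
(unordered) pairs `{h, M \ h}` of complementary halfspaces. -/
def IsHalfspaceIn {X : Type*} (μ : X → X → X → X) (M h : Set X) : Prop :=
  h ⊆ M ∧ h.Nonempty ∧ (M \ h).Nonempty ∧ ConvexIn μ M h ∧ ConvexIn μ M (M \ h)

/-- `a` and `b` are adjacent (form an edge) in `M` if exactly one wall of `M` separates
them; separating walls are represented by the halfspace containing `a` and not `b`. -/
def AdjacentIn {X : Type*} (μ : X → X → X → X) (M : Set X) (a b : X) : Prop :=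
  a ∈ M ∧ b ∈ M ∧ ∃! h : Set X, IsHalfspaceIn μ M h ∧ a ∈ h ∧ b ∉ h

/-- `λ_max^M(W)` for the wall `W = {h, M \ h}`: the maximal length `d(a,b)` of an edge
`{a,b}` of `M` crossing the wall. -/
noncomputable def lamMax {X : Type*} [MetricSpace X] (μ : X → X → X → X) (M h : Set X) : ℝ :=
  sSup {r : ℝ | ∃ a b, AdjacentIn μ M a b ∧ a ∈ h ∧ b ∈ M \ h ∧ r = dist a b}

/-- `d_μ^M(x,y) = Σ_{W ∈ 𝒲^M(x|y)} λ_max^M(W)` if `x, y ∈ M` and `0` otherwise; the walls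
separating `x` from `y` are represented by their halfspaces containing `x` and not `y`. -/
noncomputable def dmuM {X : Type*} [MetricSpace X] (μ : X → X → X → X) (M : Set X)
    (x y : X) : ℝ :=
  ∑ᶠ h ∈ {h : Set X | IsHalfspaceIn μ M h ∧ x ∈ h ∧ y ∈ M \ h}, lamMax μ M h

/-- The coordinatewise majority (median) operation on the `m`-cube `{0,1}^m`. -/
def cubeMedian (m : ℕ) (x y z : Fin m → Bool) : Fin m → Bool :=
  fun i => (x i && y i) || (y i && z i) || (z i && x i)

/-- A median algebra has rank at most `n` if it contains no `(n+1)`-cube, i.e. no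
subalgebra isomorphic (via an injective median homomorphism) to the `(n+1)`-cube with
its coordinatewise majority operation. -/
def RankLE {X : Type*} (μ : X → X → X → X) (n : ℕ) : Prop :=
  ¬∃ f : (Fin (n + 1) → Bool) → X, Function.Injective f ∧
      ∀ x y z, f (cubeMedian (n + 1) x y z) = μ (f x) (f y) (f z)

namespace MedianAlgebra

section Algebra

variable {X : Type*} {μ : X → X → X → X}

/-- A map to the two-point median algebra that commutes with medians. -/
def IsHom (μ : X → X → X → X) (φ : X → Bool) : Prop :=
  ∀ x y z, φ (μ x y z) = ((φ x && φ y) || (φ y && φ z) || (φ z && φ x))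

/-- A convex subset of a median algebra. -/
def Cvx (μ : X → X → X → X) (H : Set X) : Prop :=
  ∀ a ∈ H, ∀ b ∈ H, ∀ z, μ a b z ∈ H

theorem swap₁₂ (h : IsMedianFn μ) (x y z : X) : μ x y z = μ y x z := by
  rw [h.2.1 x y z, h.1 y z x]

theorem swap₁₃ (h : IsMedianFn μ) (x y z : X) : μ x y z = μ z y x := by
  rw [h.2.1 x y z, h.2.1 y z x, h.1 z x y]

theorem med_left (h : IsMedianFn μ) (x y : X) : μ x x y = x := h.2.2.1 x y

theorem med_right (h : IsMedianFn μ) (x y : X) : μ y x x = x := by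
  rw [h.2.1, med_left h]

theorem med_outer (h : IsMedianFn μ) (x y : X) : μ x y x = x := by
  rw [h.1, med_left h]

theorem med_assoc (h : IsMedianFn μ) (p a b c : X) :
    μ p (μ p a b) c = μ p a (μ p b c) := by
  calc μ p (μ p a b) c = μ (μ a p b) p c := by rw [swap₁₂ h p (μ p a b), swap₁₂ h p a b]
    _ = μ a (μ p p c) (μ b p c) := h.2.2.2 a p b p c
    _ = μ p a (μ p b c) := by rw [med_left h, swap₁₂ h b p c, swap₁₂ h a p]

theorem med_med_left (h : IsMedianFn μ) (p a b : X) : μ p a (μ p a b) = μ p a b := by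
  rw [← med_assoc h, med_right h]

theorem between_trans (h : IsMedianFn μ) {p α β w : X} (h1 : μ p α β = α) (h2 : μ p β w = β) :
    μ w α β = β := by
  calc μ w α β = μ (μ α p β) β w := by rw [swap₁₂ h α p β, h1, h.2.1 w α β]
    _ = μ α (μ p β w) (μ β β w) := h.2.2.2 α p β β w
    _ = β := by rw [h2, med_left h, med_right h]

/-- The union of the segments from a point to a convex set is convex. -/
theorem join_aux (h : IsMedianFn μ) {p c c' u v w : X} (hu : μ p u c = u) (hv : μ p v c' = v)
    (hw : μ w u v = w) : μ p w (μ c c' w) = w := by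
  have key : ∀ u c, μ p u c = u → μ w (μ p u w) (μ p c w) = μ p c w := by
    intro u c hu
    refine between_trans h (p := p) ?_ ?_
    · rw [← med_assoc h, med_assoc h p u w c, h.1 p w c, ← med_assoc h p u c w, hu,
        med_assoc h, med_right h]
    · rw [med_assoc h, med_right h]
  have e1 : μ w (μ p u w) (μ p v w) = w := by
    have := h.2.2.2 w u v p w
    rw [hw, med_outer h, swap₁₂ h u p w, swap₁₂ h v p w] at this
    exact this.symm
  have e2 : μ p w (μ c c' w) = μ w (μ p c w) (μ p c' w) := by
    have := h.2.2.2 w c c' p w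
    rw [swap₁₂ h c p w, swap₁₂ h c' p w] at this
    rw [← this, h.2.1 p w (μ c c' w), h.2.1 w c c', h.2.1 w]
  rw [e2, ← key u c hu, ← key v c' hv]
  rw [med_assoc h, ← med_assoc h w (μ p c w) , h.1 w (μ p c w), med_assoc h w (μ p v w),
    ← med_assoc h, e1, med_left h]

theorem split_aux (h : IsMedianFn μ) {p q c c' y z : X} (hp : μ y p c = y) (hq : μ y q c' = y)
    (hz : μ z p q = z) : μ y (μ y c c') z = y := by
  have := h.2.2.2 z p q y (μ y c c')
  rw [hz, swap₁₂ h p, swap₁₂ h q, ← med_assoc h, hp, h.1 y c c', ← med_assoc h, hq, med_left h,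
    med_left h, med_right h] at this
  rw [h.1, swap₁₂ h, h.1 y c c', this]

theorem cvx_mem (h : IsMedianFn μ) {H : Set X} (hH : Cvx μ H) {a b z : X} (ha : a ∈ H)
    (hb : b ∈ H) (hz : μ z a b = z) : z ∈ H := by
  have := hH a ha b hb z
  rwa [← h.2.1 z a b, hz] at this

theorem cvx_of_mem (h : IsMedianFn μ) {H : Set X}
    (hH : ∀ a ∈ H, ∀ b ∈ H, ∀ z, μ z a b = z → z ∈ H) : Cvx μ H := by
  intro a ha b hb z
  refine hH a ha b hb _ ?_
  calc μ (μ a b z) a b = μ (μ z a b) a b := by rw [h.2.1 z a b]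
    _ = μ z (μ a a b) (μ b a b) := h.2.2.2 _ _ _ _ _
    _ = μ a b z := by rw [med_left h, med_outer h, h.2.1 z a b]

/-- Distinct points of a median algebra are separated by a homomorphism to `Bool`. -/
theorem exists_hom (h : IsMedianFn μ) {x y : X} (hxy : x ≠ y) :
    ∃ φ : X → Bool, IsHom μ φ ∧ φ x ≠ φ y := by
  classical
  obtain ⟨H, hxH, hmax⟩ := zorn_subset_nonempty {H : Set X | Cvx μ H ∧ y ∉ H} (by
    intro c hc hchain hne
    refine ⟨⋃₀ c, ⟨?_, ?_⟩, fun s hs => Set.subset_sUnion_of_mem hs⟩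
    · rintro a ⟨s, hs, ha⟩ b ⟨t, ht, hb⟩ z
      rcases hchain.total hs ht with hst | hst
      · exact ⟨t, ht, (hc ht).1 a (hst ha) b hb z⟩
      · exact ⟨s, hs, (hc hs).1 a ha b (hst hb) z⟩
    · rintro ⟨s, hs, hy⟩
      exact (hc hs).2 hy) {x} ⟨by
        rintro a rfl b rfl z
        exact med_left h _ _, fun hy => hxy (by simpa using hy.symm)⟩
  obtain ⟨⟨hcvx, hyH⟩, hmax⟩ := hmax
  have hx : x ∈ H := hxH rfl
  have ext : ∀ p ∉ H, ∃ c ∈ H, μ y p c = y := by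
    intro p hp
    by_contra! hno
    let J : Set X := {u | ∃ c ∈ H, μ p u c = u}
    have hJ : Cvx μ J := by
      refine cvx_of_mem h ?_
      rintro u ⟨c, hc, hu⟩ v ⟨c', hc', hv⟩ w hw
      exact ⟨μ c c' w, hcvx c hc c' hc' w, join_aux h hu hv hw⟩
    have hHJ : H ⊆ J := fun u hu => ⟨u, hu, med_right h _ _⟩
    have hyJ : y ∉ J := by
      rintro ⟨c, hc, hy⟩
      exact hno c hc (by rw [swap₁₂ h, hy])
    exact hp (hmax ⟨hJ, hyJ⟩ hHJ ⟨x, hx, med_left h _ _⟩)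
  have hco : Cvx μ Hᶜ := by
    refine cvx_of_mem h ?_
    intro p hp q hq z hz hzH
    obtain ⟨c, hc, hpc⟩ := ext p hp
    obtain ⟨c', hc', hqc⟩ := ext q hq
    refine hyH (cvx_mem h hcvx (b := z) (a := μ y c c') ?_ hzH (split_aux h hpc hqc hz))
    rw [h.2.1]
    exact hcvx c hc c' hc' y
  refine ⟨fun z => decide (z ∈ H), ?_, by simp [hx, hyH]⟩
  intro a b c
  have e1 := h.2.1 a b c
  have e2 := h.2.1 b c a
  by_cases ha : a ∈ H <;> by_cases hb : b ∈ H <;> by_cases hc : c ∈ H <;>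
    simp only [ha, hb, hc, decide_true, decide_false, Bool.and_true, Bool.and_false, Bool.or_true,
      Bool.or_false, decide_eq_true_eq, decide_eq_false_iff_not, Bool.and_self, Bool.or_self]
  · exact hcvx _ ha _ hb _
  · exact hcvx _ ha _ hb _
  · rw [e1, e2]; exact hcvx _ hc _ ha _
  · rw [e1]; exact hco _ hb _ hc _
  · rw [e1]; exact hcvx _ hb _ hc _
  · rw [e1, e2]; exact hco _ hc _ ha _
  · exact hco _ ha _ hb _
  · exact hco _ ha _ hb _

theorem eq_of_hom (h : IsMedianFn μ) {x y : X} (hxy : ∀ φ, IsHom μ φ → φ x = φ y) : x = y := by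
  by_contra hne
  obtain ⟨φ, hφ, hne⟩ := exists_hom h hne
  exact hne (hxy φ hφ)

theorem med_between (h : IsMedianFn μ) (a b c : X) : μ a b (μ a b c) = μ a b c :=
  med_med_left h a b c

/-- Every finite subset of a median algebra lies in a finite subalgebra. -/
theorem exists_finite_subalgebra (h : IsMedianFn μ) {F : Set X} (hF : F.Finite) :
    ∃ M : Set X, F ⊆ M ∧ M.Finite ∧ IsSubalgebra μ M := by
  let M : Set X := {z | ∃ T : (F → Bool) → Bool, ∀ φ, IsHom μ φ → φ z = T fun i => φ i}
  refine ⟨M, fun a ha => ⟨fun v => v ⟨a, ha⟩, fun φ _ => rfl⟩, ?_, ?_⟩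
  · have : Finite F := hF
    refine @Set.toFinite _ M (Finite.of_injective (fun z : M => z.2.choose) ?_)
    intro z w hzw
    refine Subtype.ext (eq_of_hom h fun φ hφ => ?_)
    rw [z.2.choose_spec φ hφ, w.2.choose_spec φ hφ]
    exact congrFun hzw _
  · rintro a ⟨T, hT⟩ b ⟨U, hU⟩ c ⟨V, hV⟩
    refine ⟨fun v => (T v && U v) || (U v && V v) || (V v && T v), fun φ hφ => ?_⟩
    rw [hφ, hT φ hφ, hU φ hφ, hV φ hφ]

theorem halfspace_med_mem (h : IsMedianFn μ) {M k : Set X} (hM : IsSubalgebra μ M)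
    (hk : IsHalfspaceIn μ M k) {a b c : X} (ha : a ∈ k) (hb : b ∈ k) (hc : c ∈ M) :
    μ a b c ∈ k :=
  hk.2.2.2.1 a ha b hb _ (hM a (hk.1 ha) b (hk.1 hb) c hc) (med_between h a b c)

theorem halfspace_med_mem_compl (h : IsMedianFn μ) {M k : Set X} (hM : IsSubalgebra μ M)
    (hk : IsHalfspaceIn μ M k) {a b c : X} (ha : a ∈ M \ k) (hb : b ∈ M \ k) (hc : c ∈ M) :
    μ a b c ∈ M \ k :=
  hk.2.2.2.2 a ha b hb _ (hM a ha.1 b hb.1 c hc) (med_between h a b c)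

/-- The halfspaces of `M` containing `x` and not `y`. -/
def sepWalls (μ : X → X → X → X) (M : Set X) (x y : X) : Set (Set X) :=
  {k | IsHalfspaceIn μ M k ∧ x ∈ k ∧ y ∈ M \ k}

theorem sepWalls_finite {M : Set X} (hM : M.Finite) (x y : X) : (sepWalls μ M x y).Finite :=
  hM.finite_subsets.subset fun _ hk => hk.1.1

theorem sepWalls_nonempty (h : IsMedianFn μ) {M : Set X} {x y : X}
    (hx : x ∈ M) (hy : y ∈ M) (hxy : x ≠ y) : (sepWalls μ M x y).Nonempty := by
  obtain ⟨φ, hφ, hne⟩ := exists_hom h hxy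
  refine ⟨{z ∈ M | φ z = φ x}, ⟨fun z hz => hz.1, ⟨x, hx, rfl⟩, ⟨y, hy, fun hy' => hne hy'.2.symm⟩,
    ?_, ?_⟩, ⟨hx, rfl⟩, hy, fun hy' => hne hy'.2.symm⟩
  · intro a ha b hb z hz e
    refine ⟨hz, ?_⟩
    rw [← e, hφ, ha.2, hb.2]
    generalize φ x = p; generalize φ z = q
    decide +revert
  · rintro a ⟨ha, ha'⟩ b ⟨hb, hb'⟩ z hz e
    refine ⟨hz, fun hz' => ?_⟩
    have ha'' : φ a ≠ φ x := fun e => ha' ⟨ha, e⟩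
    have hb'' : φ b ≠ φ x := fun e => hb' ⟨hb, e⟩
    have hz' := hz'.2
    rw [← e, hφ] at hz'
    revert ha'' hb'' hz'
    generalize φ a = p; generalize φ b = q; generalize φ x = r; generalize φ z = s
    decide +revert

section Between

variable {M : Set X} {x y z : X}

theorem sepWalls_subset_left (h : IsMedianFn μ) (hM : IsSubalgebra μ M) (hy : y ∈ M)
    (hz : μ x y z = z) : sepWalls μ M x z ⊆ sepWalls μ M x y := by
  rintro k ⟨hk, hxk, hzk⟩
  refine ⟨hk, hxk, hy, fun hyk => hzk.2 ?_⟩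
  rw [← hz]
  exact halfspace_med_mem h hM hk hxk hyk hzk.1

theorem sepWalls_subset_right (h : IsMedianFn μ) (hM : IsSubalgebra μ M) (hx : x ∈ M)
    (hz : μ x y z = z) : sepWalls μ M z y ⊆ sepWalls μ M x y := by
  rintro k ⟨hk, hzk, hyk⟩
  refine ⟨hk, ?_, hyk⟩
  by_contra hxk
  have := halfspace_med_mem_compl h hM hk ⟨hx, hxk⟩ hyk (hk.1 hzk)
  rw [hz] at this
  exact this.2 hzk

theorem sepWalls_disjoint : Disjoint (sepWalls μ M x z) (sepWalls μ M z y) :=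
  Set.disjoint_left.2 fun _ h1 h2 => h1.2.2.2 h2.2.1

end Between

theorem sepWalls_retract (h : IsMedianFn μ) {M : Set X} (hM : IsSubalgebra μ M) {a b u v : X}
    (ha : a ∈ M) (hb : b ∈ M) (hu : u ∈ M) (hv : v ∈ M) :
    sepWalls μ M (μ a b u) (μ a b v) ⊆ sepWalls μ M u v := by
  rintro k ⟨hk, hp, hq⟩
  have swap : ∀ s, μ a b s = μ a s b ∧ μ a b s = μ b s a := fun s => ⟨h.1 _ _ _, h.2.1 _ _ _⟩
  have not_both_in : ¬ (a ∈ k ∧ b ∈ k) := fun hab =>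
    hq.2 (halfspace_med_mem h hM hk hab.1 hab.2 hv)
  have not_both_out : ¬ (a ∉ k ∧ b ∉ k) := fun hab =>
    (halfspace_med_mem_compl h hM hk ⟨ha, hab.1⟩ ⟨hb, hab.2⟩ hu).2 hp
  refine ⟨hk, ?_, hv, ?_⟩
  · by_contra hu'
    by_cases hak : a ∈ k
    · have hbk : b ∉ k := fun hbk => not_both_in ⟨hak, hbk⟩
      rw [(swap u).2] at hp
      exact (halfspace_med_mem_compl h hM hk ⟨hb, hbk⟩ ⟨hu, hu'⟩ ha).2 hp
    · rw [(swap u).1] at hp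
      exact (halfspace_med_mem_compl h hM hk ⟨ha, hak⟩ ⟨hu, hu'⟩ hb).2 hp
  · intro hv'
    by_cases hak : a ∈ k
    · rw [(swap v).1] at hq
      exact hq.2 (halfspace_med_mem h hM hk hak hv' hb)
    · have hbk : b ∈ k := by
        by_contra hbk
        exact not_both_out ⟨hak, hbk⟩
      rw [(swap v).2] at hq
      exact hq.2 (halfspace_med_mem h hM hk hbk hv' ha)

end Algebra

section Rectifiable

variable {X : Type*} [MetricSpace X] {μ : X → X → X → X} {M : Set X}

theorem lamMax_nonneg (k : Set X) : 0 ≤ lamMax μ M k := by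
  refine Real.sSup_nonneg ?_
  rintro r ⟨a, b, -, -, -, rfl⟩
  exact dist_nonneg

theorem dmuM_eq (hM : M.Finite) (x y : X) :
    dmuM μ M x y = ∑ k ∈ (sepWalls_finite (μ := μ) hM x y).toFinset, lamMax μ M k :=
  finsum_mem_eq_finite_toFinset_sum _ (sepWalls_finite (μ := μ) hM x y)

theorem dmuM_mono (hM : M.Finite) {x y u v : X} (h : sepWalls μ M x y ⊆ sepWalls μ M u v) :
    dmuM μ M x y ≤ dmuM μ M u v := by
  rw [dmuM_eq hM, dmuM_eq hM]
  exact Finset.sum_le_sum_of_subset_of_nonneg (by simpa using h) fun k _ _ => lamMax_nonneg k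

theorem dmuM_add_le (h : IsMedianFn μ) (hM : M.Finite) (hMs : IsSubalgebra μ M) {x y z : X}
    (hx : x ∈ M) (hy : y ∈ M) (hz : μ x y z = z) :
    dmuM μ M x z + dmuM μ M z y ≤ dmuM μ M x y := by
  classical
  rw [dmuM_eq hM, dmuM_eq hM, dmuM_eq hM, ← Finset.sum_union]
  · refine Finset.sum_le_sum_of_subset_of_nonneg ?_ fun k _ _ => lamMax_nonneg k
    refine Finset.union_subset ?_ ?_
    · simpa using sepWalls_subset_left h hMs hy hz
    · simpa using sepWalls_subset_right h hMs hx hz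
  · simpa using sepWalls_disjoint

theorem dist_le_lamMax (hM : M.Finite) {a b : X} {k : Set X} (hab : AdjacentIn μ M a b)
    (ha : a ∈ k) (hb : b ∈ M \ k) : dist a b ≤ lamMax μ M k := by
  refine le_csSup ?_ ⟨a, b, hab, ha, hb, rfl⟩
  refine Set.Finite.bddAbove (((hM.prod hM).image fun p => dist p.1 p.2).subset ?_)
  rintro r ⟨a, b, hab, -, -, rfl⟩
  exact ⟨(a, b), ⟨hab.1, hab.2.1⟩, rfl⟩

theorem dist_le_dmuM (h : IsMedianFn μ) (hM : M.Finite) (hMs : IsSubalgebra μ M) {x y : X}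
    (hx : x ∈ M) (hy : y ∈ M) : dist x y ≤ dmuM μ M x y := by
  induction hN : (sepWalls μ M x y).ncard using Nat.strong_induction_on generalizing x y with
  | _ N ih =>
  have split : ∀ k ∈ sepWalls μ M x y, ∀ l ∈ sepWalls μ M x y, ¬ k ⊆ l →
      dist x y ≤ dmuM μ M x y := by
    intro k hk l hl hkl
    obtain ⟨w, hwk, hwl⟩ := Set.not_subset.1 hkl
    have hwM : w ∈ M := hk.1.1 hwk
    set m := μ x y w with hm
    have hmM : m ∈ M := hMs x hx y hy w hwM
    have hbet : μ x y m = m := med_between h x y w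
    have hmk : m ∈ k := by
      rw [hm, h.1]
      exact halfspace_med_mem h hMs hk.1 hk.2.1 hwk hy
    have hml : m ∉ l := by
      rw [hm, h.2.1]
      exact (halfspace_med_mem_compl h hMs hl.1 hl.2.2 ⟨hwM, hwl⟩ hx).2
    have fin := sepWalls_finite (μ := μ) hM x y
    have h1 : (sepWalls μ M x m).ncard < N := by
      rw [← hN]
      exact Set.ncard_lt_ncard ⟨sepWalls_subset_left h hMs hy hbet,
        fun hs => (hs hk).2.2.2 hmk⟩ fin
    have h2 : (sepWalls μ M m y).ncard < N := by
      rw [← hN]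
      exact Set.ncard_lt_ncard ⟨sepWalls_subset_right h hMs hx hbet,
        fun hs => hml (hs hl).2.1⟩ fin
    calc dist x y ≤ dist x m + dist m y := dist_triangle _ _ _
      _ ≤ dmuM μ M x m + dmuM μ M m y := add_le_add (ih _ h1 hx hmM rfl) (ih _ h2 hmM hy rfl)
      _ ≤ dmuM μ M x y := dmuM_add_le h hM hMs hx hy hbet
  by_cases hxy : x = y
  · subst hxy
    rw [dist_self, dmuM_eq hM]
    exact Finset.sum_nonneg fun k _ => lamMax_nonneg k
  obtain ⟨k, hk⟩ := sepWalls_nonempty h hx hy hxy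
  by_cases hall : ∀ l ∈ sepWalls μ M x y, l = k
  · have hadj : AdjacentIn μ M x y :=
      ⟨hx, hy, k, ⟨hk.1, hk.2.1, hk.2.2.2⟩, fun l hl => hall l ⟨hl.1, hl.2.1, hy, hl.2.2⟩⟩
    refine (dist_le_lamMax hM hadj hk.2.1 hk.2.2).trans ?_
    rw [dmuM_eq hM]
    exact Finset.single_le_sum (f := lamMax μ M) (fun k _ => lamMax_nonneg k) (by simpa using hk)
  · push Not at hall
    obtain ⟨l, hl, hlk⟩ := hall
    by_cases hs : k ⊆ l
    · exact split l hl k hk fun hs' => hlk (Set.Subset.antisymm hs' hs)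
    · exact split k hk l hl hs

/-- `Len μ x y s` says that `s` is the length of a monotone chain from `x` to `y`. -/
inductive Len (μ : X → X → X → X) : X → X → ℝ → Prop
  | edge (x y : X) : Len μ x y (dist x y)
  | concat {x y z : X} {s t : ℝ} (hz : μ x y z = z) (hs : Len μ x z s) (ht : Len μ z y t) :
      Len μ x y (s + t)

/-- The supremum of the lengths of monotone chains from `x` to `y`. -/
noncomputable def chainLen (μ : X → X → X → X) (x y : X) : ℝ := sSup {s | Len μ x y s}

theorem Len.exists_finite (h : IsMedianFn μ) {x y : X} {s : ℝ} (hs : Len μ x y s) :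
    ∃ F : Set X, F.Finite ∧ x ∈ F ∧ y ∈ F ∧ ∀ M : Set X, F ⊆ M → M.Finite → IsSubalgebra μ M →
      s ≤ dmuM μ M x y := by
  induction hs with
  | edge x y =>
    refine ⟨{x, y}, by simp, by simp, by simp, fun M hF hM hMs => ?_⟩
    exact dist_le_dmuM h hM hMs (hF (by simp)) (hF (by simp))
  | concat hz _ _ ih1 ih2 =>
    obtain ⟨F1, f1, hx1, -, h1⟩ := ih1
    obtain ⟨F2, f2, -, hy2, h2⟩ := ih2
    refine ⟨F1 ∪ F2, f1.union f2, Or.inl hx1, Or.inr hy2, fun M hF hM hMs => ?_⟩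
    refine (add_le_add (h1 M (fun a ha => hF (Or.inl ha)) hM hMs)
      (h2 M (fun a ha => hF (Or.inr ha)) hM hMs)).trans ?_
    exact dmuM_add_le h hM hMs (hF (Or.inl hx1)) (hF (Or.inr hy2)) hz

/-- Uniform rectifiability with constant `L`. -/
def Rect (μ : X → X → X → X) (L : ℝ) : Prop :=
  ∀ M : Set X, M.Finite → IsSubalgebra μ M → ∀ x y : X, dmuM μ M x y ≤ L * dist x y

variable {L : ℝ}

theorem Len.le (h : IsMedianFn μ) (hL : Rect μ L) {x y : X} {s : ℝ} (hs : Len μ x y s) :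
    s ≤ L * dist x y := by
  obtain ⟨F, hF, -, -, hM⟩ := hs.exists_finite h
  obtain ⟨M, hFM, hMf, hMs⟩ := exists_finite_subalgebra h hF
  exact (hM M hFM hMf hMs).trans (hL M hMf hMs x y)

theorem chainLen_le (h : IsMedianFn μ) (hL : Rect μ L) (x y : X) :
    chainLen μ x y ≤ L * dist x y :=
  csSup_le ⟨_, Len.edge x y⟩ fun _ hs => Len.le h hL hs

theorem bddAbove_len (h : IsMedianFn μ) (hL : Rect μ L) (x y : X) :
    BddAbove {s | Len μ x y s} :=
  ⟨_, fun _ hs => Len.le h hL hs⟩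

theorem dist_le_chainLen (h : IsMedianFn μ) (hL : Rect μ L) (x y : X) :
    dist x y ≤ chainLen μ x y :=
  le_csSup (bddAbove_len h hL x y) (Len.edge x y)

theorem chainLen_add_le (h : IsMedianFn μ) (hL : Rect μ L) {x y z : X} (hz : μ x y z = z) :
    chainLen μ x z + chainLen μ z y ≤ chainLen μ x y := by
  rw [← le_sub_iff_add_le]
  refine csSup_le ⟨_, Len.edge x z⟩ fun s hs => ?_
  rw [le_sub_comm]
  refine csSup_le ⟨_, Len.edge z y⟩ fun t ht => ?_
  rw [le_sub_iff_add_le, add_comm]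
  exact le_csSup (bddAbove_len h hL x y) (Len.concat hz hs ht)

/-- Projections to intervals are `L`-Lipschitz. -/
theorem dist_retract_le (h : IsMedianFn μ) (hL : Rect μ L) (a b u v : X) :
    dist (μ a b u) (μ a b v) ≤ L * dist u v := by
  obtain ⟨M, hF, hM, hMs⟩ := exists_finite_subalgebra h (F := {a, b, u, v}) (by simp)
  have ha : a ∈ M := hF (by simp)
  have hb : b ∈ M := hF (by simp)
  have hu : u ∈ M := hF (by simp)
  have hv : v ∈ M := hF (by simp)
  exact ((dist_le_dmuM h hM hMs (hMs a ha b hb u hu) (hMs a ha b hb v hv)).trans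
    (dmuM_mono hM (sepWalls_retract h hMs ha hb hu hv))).trans (hL M hM hMs u v)

end Rectifiable

section Rank

theorem maj_left (a b : Bool) : ((a && a) || (a && b) || (b && a)) = a := by decide +revert

theorem maj_right (a b : Bool) : ((b && a) || (a && a) || (a && b)) = a := by decide +revert

theorem maj_outer (a b : Bool) : ((a && b) || (b && a) || (a && a)) = a := by decide +revert

variable {X : Type*} {μ : X → X → X → X} {n : ℕ}

/-- The join, in the interval from `z` to `a`, of the points `c i` with `ε i = true`. -/
def joinList {ι : Type*} (μ : X → X → X → X) (z a : X) (c : ι → X) (ε : ι → Bool)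
    (l : List ι) : X :=
  l.foldr (fun i t => if ε i then μ a (c i) t else t) z

theorem hom_joinList_of_forall {ι : Type*} {z a : X} {c : ι → X} {φ : X → Bool} (hφ : IsHom μ φ)
    (hc : ∀ i, φ (c i) = φ z) (ε : ι → Bool) (l : List ι) :
    φ (joinList μ z a c ε l) = φ z := by
  induction l with
  | nil => rfl
  | cons i l ih =>
    simp only [joinList, List.foldr_cons] at ih ⊢
    split_ifs
    · rw [hφ, ih, hc]
      generalize φ a = p; generalize φ z = q
      decide +revert
    · exact ih

theorem hom_joinList_of_ne {ι : Type*} [DecidableEq ι] {z a : X} {c : ι → X} {φ : X → Bool}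
    (hφ : IsHom μ φ) (hc : ∀ i, μ z a (c i) = c i) (hd : ∀ i j, i ≠ j → μ z (c i) (c j) = z)
    {i : ι} (hi : φ (c i) ≠ φ z) (ε : ι → Bool) (l : List ι) :
    φ (joinList μ z a c ε l) = if i ∈ l ∧ ε i = true then φ (c i) else φ z := by
  have ha : φ a = φ (c i) := by
    have e := congrArg φ (hc i)
    rw [hφ] at e
    revert e hi
    generalize φ a = p; generalize φ z = q; generalize φ (c i) = r
    decide +revert
  have hj : ∀ j, j ≠ i → φ (c j) = φ z := by
    intro j hj
    have e := congrArg φ (hd j i hj)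
    rw [hφ] at e
    revert e hi
    generalize φ (c j) = p; generalize φ z = q; generalize φ (c i) = r
    decide +revert
  induction l with
  | nil => simp [joinList]
  | cons j l ih =>
    simp only [joinList, List.foldr_cons] at ih ⊢
    by_cases hji : j = i
    · subst hji
      by_cases hε : ε j = true
      · simp only [hε, if_true, List.mem_cons, true_or, and_self]
        rw [hφ, ha]
        exact maj_left _ _
      · simp [hε, ih]
    · have : i ∈ j :: l ↔ i ∈ l := by simp [Ne.symm hji]
      simp only [this]
      rw [← ih]
      split_ifs
      · rw [hφ, hj j hji, ha]
        rw [ih]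
        split_ifs
        · exact maj_outer _ _
        · exact maj_right _ _
      · rfl

/-- An interval of a median algebra of rank at most `n` contains no `n + 1` pairwise disjoint
nonzero elements. -/
theorem no_disjoint_family (h : IsMedianFn μ) (hr : RankLE μ n) {z a : X} (c : Fin (n + 1) → X)
    (hc : ∀ i, μ z a (c i) = c i) (hne : ∀ i, c i ≠ z)
    (hd : ∀ i j, i ≠ j → μ z (c i) (c j) = z) : False := by
  refine hr ⟨fun ε => joinList μ z a c ε (List.finRange (n + 1)), ?_, ?_⟩
  · intro ε ε' he
    funext i
    obtain ⟨φ, hφ, hi⟩ := exists_hom h (hne i)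
    have := congrArg φ he
    simp only [hom_joinList_of_ne hφ hc hd hi, List.mem_finRange, true_and] at this
    revert this hi
    generalize φ (c i) = p; generalize φ z = q; generalize ε i = r; generalize ε' i = s
    decide +revert
  · intro x y w
    refine eq_of_hom h fun φ hφ => ?_
    by_cases hall : ∀ i, φ (c i) = φ z
    · rw [hφ]
      simp [hom_joinList_of_forall hφ hall]
    · push Not at hall
      obtain ⟨i, hi⟩ := hall
      rw [hφ]
      simp only [hom_joinList_of_ne hφ hc hd hi, List.mem_finRange, true_and, cubeMedian]
      revert hi
      generalize φ (c i) = p; generalize φ z = q; generalize x i = r; generalize y i = s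
      generalize w i = t
      decide +revert

/-- There are `m` pairwise disjoint nonzero elements in some interval with endpoints in `C`. -/
def HasFamily (μ : X → X → X → X) (C : Set X) (m : ℕ) : Prop :=
  ∃ z ∈ C, ∃ a ∈ C, ∃ c : Fin m → X, (∀ i, μ z a (c i) = c i) ∧ (∀ i, c i ≠ z) ∧
    ∀ i j, i ≠ j → μ z (c i) (c j) = z

/-- A convex set with two points of a median algebra of finite rank contains a totally ordered
interval. -/
theorem exists_chain_interval (h : IsMedianFn μ) (hr : RankLE μ n) {C : Set X} (hC : Cvx μ C)
    {x y : X} (hx : x ∈ C) (hy : y ∈ C) (hxy : x ≠ y) :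
    ∃ z ∈ C, ∃ c ∈ C, z ≠ c ∧ ∀ p q, μ z c p = p → μ z c q = q → μ z p q = p ∨ μ z p q = q := by
  have h1 : HasFamily μ C 1 := ⟨x, hx, y, hy, fun _ => y, fun _ => med_right h _ _,
    fun _ => hxy.symm, fun i j hij => absurd (Subsingleton.elim i j) hij⟩
  have hn : ¬ HasFamily μ C (n + 1) := fun ⟨z, _, a, _, c, hc, hne, hd⟩ =>
    no_disjoint_family h hr c hc hne hd
  obtain ⟨m, hm, hm'⟩ : ∃ m, HasFamily μ C (m + 1) ∧ ¬ HasFamily μ C (m + 2) := by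
    by_contra! hno
    have : ∀ m, HasFamily μ C (m + 1) := by
      intro m
      induction m with
      | zero => exact h1
      | succ m ih => exact hno m ih
    exact hn (this n)
  obtain ⟨z, hz, a, ha, c, hc, hne, hd⟩ := hm
  refine ⟨z, hz, c 0, ?_, (hne 0).symm, ?_⟩
  · rw [← hc 0]; exact hC z hz a ha _
  intro p q hp hq
  by_contra! hpq
  apply hm'
  have hc0 := hc 0
  have key : ∀ i : Fin m, c i.succ ≠ z ∧ μ z a (c i.succ) = c i.succ ∧
      μ z (c 0) (c i.succ) = z := fun i => ⟨hne _, hc _, hd _ _ (Fin.succ_ne_zero i).symm⟩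
  have below : ∀ u v, μ z (c 0) u = u → μ (μ z u v) a u = u := by
    intro u v hu
    refine eq_of_hom h fun φ hφ => ?_
    have e1 := congrArg φ hu
    have e2 := congrArg φ hc0
    simp only [hφ _ _ _] at e1 e2 ⊢
    revert e1 e2
    generalize φ z = z; generalize φ a = a; generalize φ (c 0) = r; generalize φ u = u
    generalize φ v = v
    decide +revert
  have disj : ∀ u v, μ z (c 0) u = u → ∀ i : Fin m,
      μ (μ z u v) u (μ a (c i.succ) (μ z u v)) = μ z u v := by
    intro u v hu i
    refine eq_of_hom h fun φ hφ => ?_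
    have e1 := congrArg φ hu
    have e2 := congrArg φ hc0
    have e3 := congrArg φ (key i).2.1
    have e4 := congrArg φ (key i).2.2
    simp only [hφ _ _ _] at e1 e2 e3 e4 ⊢
    revert e1 e2 e3 e4
    generalize φ z = z; generalize φ a = a; generalize φ (c 0) = r; generalize φ u = u
    generalize φ v = v; generalize φ (c i.succ) = s
    decide +revert
  refine ⟨μ z p q, ?_, a, ha,
    Fin.cons p (Fin.cons q fun i : Fin m => μ a (c i.succ) (μ z p q)), ?_, ?_, ?_⟩
  · have hpC : p ∈ C := by
      rw [← hp, ← hc0]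
      exact hC z hz _ (hC z hz a ha _) p
    exact hC z hz p hpC q
  · intro i
    refine Fin.cases ?_ (fun i => Fin.cases ?_ (fun i => ?_) i) i
    · exact below p q hp
    · simp only [Fin.cons_succ, Fin.cons_zero]
      rw [h.1 z p q]
      exact below q p hq
    · simp only [Fin.cons_succ]
      rw [h.1 a, swap₁₂ h (μ z p q) a, med_med_left h]
  · intro i
    refine Fin.cases ?_ (fun i => Fin.cases ?_ (fun i => ?_) i) i
    · exact hpq.1.symm
    · exact hpq.2.symm
    · simp only [Fin.cons_succ]
      intro e
      refine (key i).1 (eq_of_hom h fun φ hφ => ?_)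
      have e1 := congrArg φ hp
      have e2 := congrArg φ hc0
      have e3 := congrArg φ (key i).2.1
      have e4 := congrArg φ (key i).2.2
      have e5 := congrArg φ e
      simp only [hφ _ _ _] at e1 e2 e3 e4 e5
      revert e1 e2 e3 e4 e5
      generalize φ z = z; generalize φ a = a; generalize φ (c 0) = r; generalize φ p = p
      generalize φ q = q; generalize φ (c i.succ) = s
      decide +revert
  · intro i j
    have sym : ∀ u v, μ (μ z p q) u v = μ z p q → μ (μ z p q) v u = μ z p q := by
      intro u v e
      rwa [h.1]
    have hpq' : μ (μ z p q) p q = μ z p q := by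
      rw [h.2.1, h.2.1 z p q, med_between h p q z]
    have hq' : ∀ i : Fin m, μ (μ z p q) q (μ a (c i.succ) (μ z p q)) = μ z p q := by
      rw [h.1 z p q]
      exact disj q p hq
    have hij : ∀ i j : Fin m, i ≠ j →
        μ (μ z p q) (μ a (c i.succ) (μ z p q)) (μ a (c j.succ) (μ z p q)) = μ z p q := by
      intro i j hij
      have hdij := hd i.succ j.succ (fun e => hij (Fin.succ_injective _ e))
      refine eq_of_hom h fun φ hφ => ?_
      have e1 := congrArg φ (key i).2.1
      have e2 := congrArg φ (key j).2.1
      have e3 := congrArg φ hdij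
      have e4 := congrArg φ hp
      have e5 := congrArg φ hc0
      simp only [hφ _ _ _] at e1 e2 e3 e4 e5 ⊢
      revert e1 e2 e3 e4 e5
      generalize φ z = z; generalize φ a = a; generalize φ (c i.succ) = s
      generalize φ (c j.succ) = t; generalize φ p = p; generalize φ q = q; generalize φ (c 0) = r
      decide +revert
    refine Fin.cases ?_ (fun i => Fin.cases ?_ (fun i => ?_) i) i <;>
      refine Fin.cases ?_ (fun j => Fin.cases ?_ (fun j => ?_) j) j <;>
      simp only [Fin.cons_succ, Fin.cons_zero, ne_eq, not_true_eq_false, false_imp_iff]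
    · exact fun _ => hpq'
    · exact fun _ => disj p q hp j
    · exact fun _ => sym _ _ hpq'
    · exact fun _ => hq' j
    · exact fun _ => sym _ _ (disj p q hp i)
    · exact fun _ => sym _ _ (hq' i)
    · exact fun e => hij i j fun e' => e (by rw [e'])

/-- `z` is in the convex hull of `F`. -/
def InHull (μ : X → X → X → X) (F : Finset X) (z : X) : Prop :=
  ∀ φ, IsHom μ φ → ∃ a ∈ F, φ a = φ z

/-- The meet, in the order based at `z`, of `a` and the elements of `l`. -/
def meetList (μ : X → X → X → X) (z a : X) (l : List X) : X :=
  l.foldr (fun b t => μ z b t) a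

theorem hom_meetList {φ : X → Bool} (hφ : IsHom μ φ) (z a : X) (l : List X) :
    φ (meetList μ z a l) = φ z ↔ φ a = φ z ∨ ∃ b ∈ l, φ b = φ z := by
  induction l with
  | nil => simp [meetList]
  | cons b l ih =>
    have e : φ (meetList μ z a (b :: l)) = φ z ↔ φ b = φ z ∨ φ (meetList μ z a l) = φ z := by
      change φ (μ z b (meetList μ z a l)) = φ z ↔ _
      rw [hφ]
      generalize φ z = p; generalize φ b = q; generalize φ (meetList μ z a l) = r
      decide +revert
    rw [e, ih]
    simp only [List.mem_cons, exists_eq_or_imp]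
    tauto

/-- A Caratheodory theorem for median algebras of finite rank. -/
theorem InHull.exists_card_le (h : IsMedianFn μ) (hr : RankLE μ n) {z : X} (F : Finset X)
    (hF : InHull μ F z) : ∃ F' ⊆ F, F'.card ≤ n + 1 ∧ InHull μ F' z := by
  classical
  induction F using Finset.strongInduction with
  | H F ih =>
  by_cases hcard : F.card ≤ n + 1
  · exact ⟨F, subset_rfl, hcard, hF⟩
  by_cases hred : ∃ a ∈ F, InHull μ (F.erase a) z
  · obtain ⟨a, ha, hFa⟩ := hred
    obtain ⟨F', h1, h2, h3⟩ := ih _ (Finset.erase_ssubset ha) hFa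
    exact ⟨F', h1.trans (Finset.erase_subset _ _), h2, h3⟩
  exfalso
  push Not at hcard hred
  obtain ⟨a, ha⟩ : F.Nonempty := Finset.card_pos.1 (by omega)
  have hle : n + 1 ≤ (F.erase a).card := by rw [Finset.card_erase_of_mem ha]; omega
  obtain ⟨e⟩ : Nonempty (Fin (n + 1) ↪ (F.erase a : Finset X)) :=
    Function.Embedding.nonempty_of_card_le (by simpa using hle)
  have hea : ∀ i, (e i : X) ≠ a := fun i => (Finset.mem_erase.1 (e i).2).1
  have heF : ∀ i, (e i : X) ∈ F := fun i => (Finset.mem_erase.1 (e i).2).2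
  refine no_disjoint_family h hr (z := z) (a := a)
    (fun i => meetList μ z a (F.erase (e i)).toList) ?_ ?_ ?_
  · intro i
    refine eq_of_hom h fun φ hφ => ?_
    have e1 := (hom_meetList hφ z a (F.erase (e i)).toList).2
    rw [hφ]
    by_cases haz : φ a = φ z
    · rw [e1 (Or.inl haz), haz]
      simp
    · revert haz
      generalize φ a = p; generalize φ z = q
      generalize φ (meetList μ z a (F.erase (e i)).toList) = r
      decide +revert
  · intro i hi
    have := hred (e i) (heF i)
    simp only [InHull] at this
    push Not at this
    obtain ⟨φ, hφ, hne⟩ := this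
    rcases (hom_meetList hφ z a (F.erase (e i)).toList).1 (congrArg φ hi) with h1 | ⟨b, hb, h1⟩
    · exact hne a (Finset.mem_erase.2 ⟨(hea i).symm, ha⟩) h1
    · exact hne b (Finset.mem_toList.1 hb) h1
  · intro i j hij
    refine eq_of_hom h fun φ hφ => ?_
    obtain ⟨b, hb, hbz⟩ := hF φ hφ
    have e1 := (hom_meetList hφ z a (F.erase (e i)).toList).2
    have e2 := (hom_meetList hφ z a (F.erase (e j)).toList).2
    rw [hφ]
    by_cases hbi : b = e i
    · have hbj : b ≠ e j := fun hbj => hij (e.injective (Subtype.ext (hbi.symm.trans hbj)))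
      rw [e2 (Or.inr ⟨b, Finset.mem_toList.2 (Finset.mem_erase.2 ⟨hbj, hb⟩), hbz⟩)]
      exact maj_outer _ _
    · rw [e1 (Or.inr ⟨b, Finset.mem_toList.2 (Finset.mem_erase.2 ⟨hbi, hb⟩), hbz⟩)]
      exact maj_left _ _

/-- The convex hull of `A`. -/
def hull (μ : X → X → X → X) (A : Set X) : Set X :=
  {z | ∃ F : Finset X, ↑F ⊆ A ∧ InHull μ F z}

theorem subset_hull (A : Set X) : A ⊆ hull μ A := fun a ha =>
  ⟨{a}, by simpa using ha, fun φ _ => ⟨a, by simp, rfl⟩⟩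

theorem cvx_hull (A : Set X) : Cvx μ (hull μ A) := by
  classical
  rintro a ⟨F, hF, hFa⟩ b ⟨F', hF', hFb⟩ z
  refine ⟨F ∪ F', by simp [hF, hF'], fun φ hφ => ?_⟩
  obtain ⟨u, hu, hua⟩ := hFa φ hφ
  obtain ⟨v, hv, hvb⟩ := hFb φ hφ
  have : φ a = φ (μ a b z) ∨ φ b = φ (μ a b z) := by
    rw [hφ]
    generalize φ a = p; generalize φ b = q; generalize φ z = r
    decide +revert
  rcases this with h1 | h1
  · exact ⟨u, by simp [hu], hua.trans h1⟩
  · exact ⟨v, by simp [hv], hvb.trans h1⟩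

end Rank

section Compactness

open Filter Topology

theorem exists_tendsto_of_dist_le {X ι : Type*} [MetricSpace X] [CompleteSpace X] [Preorder ι]
    [Nonempty ι] [IsDirectedOrder ι] {p : ι → X} {f : ι → ℝ} {b : ℝ} (hf : Tendsto f atTop (𝓝 b))
    (hd : ∀ i j, i ≤ j → dist (p i) (p j) ≤ |f i - f j|) : ∃ l, Tendsto p atTop (𝓝 l) := by
  suffices hc : Cauchy (map p atTop) from CompleteSpace.complete hc
  refine Metric.cauchy_iff.2 ⟨inferInstance, fun ε hε => ?_⟩
  obtain ⟨i, hi⟩ := eventually_atTop.1 (Metric.tendsto_nhds.1 hf (ε / 4) (by positivity))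
  refine ⟨p '' Set.Ici i, image_mem_map (Ici_mem_atTop i), ?_⟩
  have key : ∀ j, i ≤ j → dist (p i) (p j) < ε / 2 := by
    intro j hj
    refine (hd i j hj).trans_lt ?_
    have h1 := hi i le_rfl
    have h2 := hi j hj
    rw [Real.dist_eq, abs_lt] at h1 h2
    rw [abs_lt]
    constructor <;> linarith
  rintro _ ⟨j, hj, rfl⟩ _ ⟨k, hk, rfl⟩
  have h1 := key j hj
  have h2 := key k hk
  have h3 := dist_triangle_left (p j) (p k) (p i)
  linarith

variable {X : Type*} {μ : X → X → X → X}

/-- `p` is the gate of `x` in `H`. -/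
def IsGate (μ : X → X → X → X) (H : Set X) (x p : X) : Prop :=
  p ∈ H ∧ ∀ u ∈ H, μ x u p = p

theorem Cvx.inter {H K : Set X} (hH : Cvx μ H) (hK : Cvx μ K) : Cvx μ (H ∩ K) :=
  fun a ha b hb z => ⟨hH a ha.1 b hb.1 z, hK a ha.2 b hb.2 z⟩

theorem Cvx.sInter {S : Set (Set X)} (hS : ∀ H ∈ S, Cvx μ H) : Cvx μ (⋂₀ S) :=
  fun a ha b hb z H hH => hS H hH a (ha H hH) b (hb H hH) z

/-- Finitely many pairwise intersecting convex sets have a common point. -/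
theorem helly (h : IsMedianFn μ) {ι : Type*} [DecidableEq ι] (S : Finset ι) (A : ι → Set X)
    (hA : ∀ i ∈ S, Cvx μ (A i)) (hmeet : ∀ i ∈ S, ∀ j ∈ S, (A i ∩ A j).Nonempty)
    (hS : S.Nonempty) : ∃ x, ∀ i ∈ S, x ∈ A i := by
  induction S using Finset.induction_on generalizing A with
  | empty => simp at hS
  | insert a S ha ih =>
    have haS : a ∈ insert a S := Finset.mem_insert_self _ _
    have hsub : ∀ {i}, i ∈ S → i ∈ insert a S := fun hi => Finset.mem_insert_of_mem hi
    by_cases hne : S.Nonempty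
    · obtain ⟨x, hx⟩ := ih (fun i => A i ∩ A a)
        (fun i hi => (hA i (hsub hi)).inter (hA a haS)) (fun i hi j hj => by
          obtain ⟨x, hxi, hxj⟩ := hmeet i (hsub hi) j (hsub hj)
          obtain ⟨y, hyj, hya⟩ := hmeet j (hsub hj) a haS
          obtain ⟨z, hza, hzi⟩ := hmeet a haS i (hsub hi)
          have hi' : μ x y z ∈ A i := by
            rw [h.1]; exact hA i (hsub hi) x hxi z hzi y
          have ha' : μ x y z ∈ A a := by
            rw [h.2.1]; exact hA a haS y hya z hza x
          exact ⟨μ x y z, ⟨hi', ha'⟩, hA j (hsub hj) x hxj y hyj z, ha'⟩) hne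
      refine ⟨x, fun i hi => ?_⟩
      rcases Finset.mem_insert.1 hi with rfl | hi
      · obtain ⟨j, hj⟩ := hne
        exact (hx j hj).2
      · exact (hx i hi).1
    · rw [Finset.not_nonempty_iff_eq_empty] at hne
      subst hne
      obtain ⟨x, hx, -⟩ := hmeet a haS a haS
      exact ⟨x, by simpa using hx⟩

variable [MetricSpace X] {L : ℝ}

theorem continuous_med (hcont : Continuous fun p : X × X × X => μ p.1 p.2.1 p.2.2) (a b : X) :
    Continuous (μ a b) :=
  hcont.comp (by fun_prop : Continuous fun z : X => (a, b, z))

theorem dist_le_sub_of_between (h : IsMedianFn μ) (hL : Rect μ L) {x y z : X}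
    (hz : μ x y z = z) : dist z y ≤ chainLen μ x y - chainLen μ x z := by
  have h1 := chainLen_add_le h hL hz
  have h2 := dist_le_chainLen h hL z y
  linarith

/-- The closure of a convex set is convex. -/
theorem Cvx.closure (hcont : Continuous fun p : X × X × X => μ p.1 p.2.1 p.2.2) {H : Set X}
    (hH : Cvx μ H) : Cvx μ (closure H) := fun a ha b hb z =>
  map_mem_closure₂ (f := fun a b => μ a b z)
    (hcont.comp (by fun_prop : Continuous fun q : X × X => (q.1, q.2, z))) ha hb
    fun a ha b hb => hH a ha b hb z

theorem dist_meetList_le (h : IsMedianFn μ) (hL : Rect μ L) (hL0 : 0 ≤ L) {R : ℝ} (hR : 0 ≤ R)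
    (x : X) (k : ℕ) : ∃ B, R ≤ B ∧ ∀ (z a : X) (l : List X), l.length ≤ k → dist a x ≤ R →
      (∀ b ∈ l, dist b x ≤ R) → dist (meetList μ z a l) x ≤ B := by
  induction k with
  | zero =>
    refine ⟨R, le_rfl, fun z a l hl ha _ => ?_⟩
    obtain rfl : l = [] := List.length_eq_zero_iff.1 (by omega)
    exact ha
  | succ k ih =>
    obtain ⟨B, hRB, hB⟩ := ih
    have hpos : 0 ≤ L * (R + B) := mul_nonneg hL0 (by linarith)
    refine ⟨B + L * (R + B), by linarith, fun z a l hl ha hlR => ?_⟩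
    cases l with
    | nil =>
      change dist a x ≤ _
      linarith
    | cons b l =>
      have ht := hB z a l (by simpa using hl) ha fun c hc => hlR c (List.mem_cons_of_mem _ hc)
      have hb := hlR b List.mem_cons_self
      change dist (μ z b (meetList μ z a l)) x ≤ _
      set t := meetList μ z a l
      have h1 := dist_retract_le h hL t z b t
      rw [med_outer h, h.2.1 t z b] at h1
      have h2 := dist_triangle (μ z b t) t x
      have h3 := dist_triangle_right b t x
      have h4 : L * dist b t ≤ L * (R + B) := mul_le_mul_of_nonneg_left (by linarith) hL0
      linarith

theorem isBounded_hull (h : IsMedianFn μ) {n : ℕ} (hr : RankLE μ n) (hL : Rect μ L) (hL0 : 0 ≤ L)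
    {A : Set X} (hA : Bornology.IsBounded A) {x : X} (hx : x ∈ A) :
    Bornology.IsBounded (hull μ A) := by
  obtain ⟨R, hR⟩ := Metric.isBounded_iff.1 hA
  have hR0 : 0 ≤ R := dist_nonneg.trans (hR hx hx)
  obtain ⟨B, -, hB⟩ := dist_meetList_le h hL hL0 hR0 x (n + 1)
  refine (Metric.isBounded_closedBall (x := x) (r := B)).subset ?_
  rintro z ⟨F, hFA, hF⟩
  obtain ⟨F', hF'F, hcard, hF'⟩ := hF.exists_card_le h hr
  have hF'A : ∀ b ∈ F', b ∈ A := fun b hb => hFA (hF'F hb)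
  obtain ⟨a, ha, -⟩ := hF' (fun _ => true) fun _ _ _ => rfl
  have hz : meetList μ z a F'.toList = z := by
    refine eq_of_hom h fun φ hφ => (hom_meetList hφ _ _ _).2 (Or.inr ?_)
    simpa using hF' φ hφ
  rw [Metric.mem_closedBall, ← hz]
  exact hB z a _ (by simpa using hcard) (hR (hF'A a ha) hx)
    fun b hb => hR (hF'A b (Finset.mem_toList.1 hb)) hx

variable [CompleteSpace X]

theorem exists_gate (h : IsMedianFn μ)
    (hcont : Continuous fun p : X × X × X => μ p.1 p.2.1 p.2.2) (hL : Rect μ L)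
    {H : Set X} (hH : Cvx μ H) (hcl : IsClosed H) (hne : H.Nonempty) (x : X) :
    ∃ p, IsGate μ H x p := by
  let pre : Preorder H :=
    { le := fun u v => μ x u v = v
      le_refl := fun u => med_right h _ _
      le_trans := fun u v w (huv : μ x u v = v) (hvw : μ x v w = w) => by
        rw [← hvw, ← med_assoc h, huv] }
  have hdir : IsDirectedOrder H := ⟨fun u v => by
    refine ⟨⟨μ x u v, ?_⟩, ?_, ?_⟩
    · rw [h.2.1]; exact hH u u.2 v v.2 x
    · exact med_med_left h _ _ _
    · change μ x v (μ x u v) = μ x u v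
      rw [h.1 x u v]; exact med_med_left h _ _ _⟩
  have hneH : Nonempty H := hne.to_subtype
  have hanti : Antitone fun u : H => chainLen μ x u := fun u v huv => by
    have := dist_le_sub_of_between h hL (x := x) (y := u) (z := v) huv
    have := dist_nonneg (x := (v : X)) (y := u)
    change chainLen μ x v ≤ chainLen μ x u
    linarith
  have hbdd : BddBelow (Set.range fun u : H => chainLen μ x u) := by
    refine ⟨0, ?_⟩
    rintro _ ⟨u, rfl⟩
    exact dist_nonneg.trans (dist_le_chainLen h hL x u)
  obtain ⟨p, hp⟩ := exists_tendsto_of_dist_le (p := fun u : H => (u : X))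
    (tendsto_atTop_ciInf hanti hbdd) (fun u v huv => by
      rw [dist_comm]
      exact (dist_le_sub_of_between h hL (x := x) (y := u) (z := v) huv).trans (le_abs_self _))
  refine ⟨p, hcl.mem_of_tendsto hp (Eventually.of_forall fun u => u.2), fun u hu => ?_⟩
  refine tendsto_nhds_unique (((continuous_med hcont x u).tendsto p).comp hp) (hp.congr' ?_)
  filter_upwards [Ici_mem_atTop (⟨u, hu⟩ : H)] with v hv
  exact (Eq.symm hv)

/-- Pairwise intersecting closed convex sets, one of which is bounded, have a common point. -/
theorem sInter_nonempty (h : IsMedianFn μ)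
    (hcont : Continuous fun p : X × X × X => μ p.1 p.2.1 p.2.2) (hL : Rect μ L) (hL0 : 0 ≤ L)
    {S : Set (Set X)} (hS : ∀ H ∈ S, Cvx μ H ∧ IsClosed H)
    (hmeet : ∀ H ∈ S, ∀ K ∈ S, (H ∩ K).Nonempty) {C : Set X} (hCS : C ∈ S)
    (hC : Bornology.IsBounded C) : (⋂₀ S).Nonempty := by
  classical
  obtain ⟨x, hxC, -⟩ := hmeet C hCS C hCS
  let T : Finset S → Set X := fun F => ⋂₀ (insert C (Subtype.val '' (F : Set S)))
  have hmem : ∀ F : Finset S, ∀ H ∈ insert C (Subtype.val '' (F : Set S)), H ∈ S := by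
    rintro F H (rfl | ⟨H, -, rfl⟩)
    · exact hCS
    · exact H.2
  have hT : ∀ F, ∃ p, IsGate μ (T F) x p := by
    intro F
    refine exists_gate h hcont hL (Cvx.sInter fun H hH => (hS H (hmem F H hH)).1)
      (isClosed_sInter fun H hH => (hS H (hmem F H hH)).2) ?_ x
    obtain ⟨y, hy⟩ := helly h (insert ⟨C, hCS⟩ F) (fun H : S => (H : Set X))
      (fun H _ => (hS H H.2).1) (fun H _ K _ => hmeet H H.2 K K.2) (Finset.insert_nonempty _ _)
    refine ⟨y, ?_⟩
    rintro H (rfl | ⟨H, hH, rfl⟩)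
    · exact hy ⟨H, hCS⟩ (Finset.mem_insert_self _ _)
    · exact hy H (Finset.mem_insert_of_mem hH)
  choose p hp using hT
  have hTanti : ∀ F G, F ⊆ G → T G ⊆ T F := fun F G hFG =>
    Set.sInter_subset_sInter (Set.insert_subset_insert (Set.image_mono (by exact_mod_cast hFG)))
  have hpC : ∀ F, p F ∈ C := fun F => (hp F).1 C (Set.mem_insert _ _)
  have hbet : ∀ F G, F ≤ G → dist (p F) (p G) ≤ chainLen μ x (p G) - chainLen μ x (p F) := by
    intro F G hFG
    exact dist_le_sub_of_between h hL ((hp F).2 _ (hTanti F G hFG (hp G).1))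
  have hmono : Monotone fun F => chainLen μ x (p F) := fun F G hFG => by
    have := hbet F G hFG
    have := dist_nonneg (x := p F) (y := p G)
    change chainLen μ x (p F) ≤ chainLen μ x (p G)
    linarith
  have hbdd : BddAbove (Set.range fun F => chainLen μ x (p F)) := by
    obtain ⟨R, hR⟩ := Metric.isBounded_iff.1 hC
    refine ⟨L * R, ?_⟩
    rintro _ ⟨F, rfl⟩
    exact (chainLen_le h hL _ _).trans (mul_le_mul_of_nonneg_left (hR hxC (hpC F)) hL0)
  obtain ⟨q, hq⟩ := exists_tendsto_of_dist_le (tendsto_atTop_ciSup hmono hbdd) (fun F G hFG => by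
    rw [abs_sub_comm]
    exact (hbet F G hFG).trans (le_abs_self _))
  refine ⟨q, fun H hH => (hS H hH).2.mem_of_tendsto hq ?_⟩
  filter_upwards [Ici_mem_atTop ({⟨H, hH⟩} : Finset S)] with F hF
  refine (hp F).1 H (Set.mem_insert_of_mem _ ⟨⟨H, hH⟩, ?_, rfl⟩)
  exact hF (Finset.mem_singleton_self _)

/-- Disjoint closed convex sets are at positive distance. -/
theorem exists_pos_le_dist (h : IsMedianFn μ)
    (hcont : Continuous fun p : X × X × X => μ p.1 p.2.1 p.2.2) (hL : Rect μ L) (hL0 : 0 < L)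
    {A B : Set X} (hA : Cvx μ A) (hB : Cvx μ B) (hAc : IsClosed A) (hBc : IsClosed B)
    (hAn : A.Nonempty) (hBn : B.Nonempty) (hAB : Disjoint A B) :
    ∃ η > 0, ∀ u ∈ A, ∀ v ∈ B, η ≤ dist u v := by
  obtain ⟨a, ha⟩ := hAn
  obtain ⟨b, hb, hab⟩ := exists_gate h hcont hL hB hBc hBn a
  obtain ⟨a', ha', hba⟩ := exists_gate h hcont hL hA hAc ⟨a, ha⟩ b
  have hne : a' ≠ b := fun e => Set.disjoint_left.1 hAB ha' (e ▸ hb)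
  refine ⟨dist a' b / L, div_pos (dist_pos.2 hne) hL0, fun u hu v hv => ?_⟩
  rw [div_le_iff₀' hL0]
  have hu' : μ a' b u = a' := by rw [h.2.1 a' b u]; exact hba u hu
  have hv' : μ a' b v = b := by
    have h1 := hba a ha
    have h2 := hab v hv
    refine eq_of_hom h fun φ hφ => ?_
    have e1 := congrArg φ h1
    have e2 := congrArg φ h2
    simp only [hφ _ _ _] at e1 e2 ⊢
    revert e1 e2
    generalize φ a = s; generalize φ a' = t; generalize φ b = u; generalize φ v = w
    decide +revert
  have := dist_retract_le h hL a' b u v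
  rwa [hu', hv'] at this

end Compactness

section FixedPoint

open Bornology

theorem Cvx.preimage_smul {X G : Type*} [Group G] [MulAction G X] {μ : X → X → X → X}
    (hequiv : ∀ (g : G) (x y z : X), g • μ x y z = μ (g • x) (g • y) (g • z))
    {H : Set X} (hH : Cvx μ H) (g : G) : Cvx μ {w | g • w ∈ H} := fun a ha b hb z => by
  change g • μ a b z ∈ H
  rw [hequiv]
  exact hH _ ha _ hb _

variable {X : Type*} [MetricSpace X] {μ : X → X → X → X} {L : ℝ}

theorem Len.map {f : X → X} (hf : Isometry f)
    (hμ : ∀ x y z, f (μ x y z) = μ (f x) (f y) (f z)) {x y : X} {s : ℝ} (hs : Len μ x y s) :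
    Len μ (f x) (f y) s := by
  induction hs with
  | edge x y => rw [← hf.dist_eq]; exact .edge _ _
  | concat hz _ _ ih₁ ih₂ => exact .concat (by rw [← hμ, hz]) ih₁ ih₂

theorem chainLen_le_map (h : IsMedianFn μ) (hL : Rect μ L) {f : X → X} (hf : Isometry f)
    (hμ : ∀ x y z, f (μ x y z) = μ (f x) (f y) (f z)) (x y : X) :
    chainLen μ x y ≤ chainLen μ (f x) (f y) :=
  csSup_le ⟨_, Len.edge x y⟩ fun _ hs => le_csSup (bddAbove_len h hL _ _) (hs.map hf hμ)

/-- A nontrivial closed convex set is covered by two proper closed convex subsets. -/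
theorem exists_cover [ConnectedSpace X] (h : IsMedianFn μ)
    (hcont : Continuous fun p : X × X × X => μ p.1 p.2.1 p.2.2) {n : ℕ} (hr : RankLE μ n)
    {C : Set X} (hC : Cvx μ C) (hCc : IsClosed C) {x y : X} (hx : x ∈ C) (hy : y ∈ C)
    (hxy : x ≠ y) :
    ∃ H K : Set X, H ⊆ C ∧ K ⊆ C ∧ C ⊆ H ∪ K ∧ Cvx μ H ∧ Cvx μ K ∧ IsClosed H ∧ IsClosed K ∧
      H.Nonempty ∧ K.Nonempty ∧ (C \ H).Nonempty ∧ (C \ K).Nonempty := by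
  obtain ⟨z, hz, c, hc, hzc, hchain⟩ := exists_chain_interval h hr hC hx hy hxy
  have hm := continuous_med hcont
  obtain ⟨e, he, hez, hec⟩ : ∃ e, μ z c e = e ∧ e ≠ z ∧ e ≠ c := by
    by_contra! hno
    obtain ⟨w, -, hwz, hwc⟩ := isPreconnected_closed_iff.1 (isPreconnected_univ (α := X))
      {w | μ z c w = z} {w | μ z c w = c} (isClosed_eq (hm z c) continuous_const)
      (isClosed_eq (hm z c) continuous_const) (fun w _ => by
        by_cases hw : μ z c w = z
        · exact Or.inl hw
        · exact Or.inr (hno _ (med_med_left h z c w) hw))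
      ⟨z, trivial, med_outer h _ _⟩ ⟨c, trivial, med_right h _ _⟩
    exact hzc (hwz.symm.trans hwc)
  refine ⟨C ∩ {w | μ z c w = μ z e w}, C ∩ {w | μ z c w = μ e c w}, Set.inter_subset_left,
    Set.inter_subset_left, fun w hw => ?_, hC.inter ?_, hC.inter ?_,
    hCc.inter (isClosed_eq (hm _ _) (hm _ _)), hCc.inter (isClosed_eq (hm _ _) (hm _ _)),
    ⟨z, hz, ?_⟩, ⟨c, hc, ?_⟩, ⟨c, hc, fun hcH => ?_⟩, ⟨z, hz, fun hzK => ?_⟩⟩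
  · refine (hchain (μ z c w) e (med_med_left h z c w) he).imp (fun h1 => ⟨hw, ?_⟩)
      fun h1 => ⟨hw, ?_⟩
    all_goals
      refine eq_of_hom h fun φ hφ => ?_
      have e1 := congrArg φ h1
      have e2 := congrArg φ he
      simp only [hφ _ _ _] at e1 e2 ⊢
      revert e1 e2
      generalize φ z = s; generalize φ c = t; generalize φ e = u; generalize φ w = v
      decide +revert
  · intro a (ha : _ = _) b (hb : _ = _) w
    refine eq_of_hom h fun φ hφ => ?_
    have e0 := congrArg φ he
    have e1 := congrArg φ ha
    have e2 := congrArg φ hb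
    simp only [hφ _ _ _] at e0 e1 e2 ⊢
    revert e0 e1 e2
    generalize φ z = s; generalize φ c = t; generalize φ e = u; generalize φ w = v
    generalize φ a = p; generalize φ b = q
    decide +revert
  · intro a (ha : _ = _) b (hb : _ = _) w
    refine eq_of_hom h fun φ hφ => ?_
    have e0 := congrArg φ he
    have e1 := congrArg φ ha
    have e2 := congrArg φ hb
    simp only [hφ _ _ _] at e0 e1 e2 ⊢
    revert e0 e1 e2
    generalize φ z = s; generalize φ c = t; generalize φ e = u; generalize φ w = v
    generalize φ a = p; generalize φ b = q
    decide +revert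
  · change μ z c z = μ z e z
    rw [med_outer h, med_outer h]
  · change μ z c c = μ e c c
    rw [med_right h, med_right h]
  · have h1 : μ z c c = μ z e c := hcH.2
    rw [med_right h, h.1, he] at h1
    exact hec h1.symm
  · have h1 : μ z c z = μ e c z := hzK.2
    rw [med_outer h, swap₁₃ h, he] at h1
    exact hez h1.symm

/-- The supremum of the chain lengths from points of `C \ H` to their gates in `H`. -/
noncomputable def depth (μ : X → X → X → X) (C H : Set X) : ℝ :=
  sSup {r | ∃ q ∈ C \ H, ∃ p, IsGate μ H q p ∧ r = chainLen μ q p}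

theorem le_depth (h : IsMedianFn μ) (hL : Rect μ L) (hL0 : 0 ≤ L) {C H : Set X}
    (hC : IsBounded C) (hHC : H ⊆ C) {q p : X} (hq : q ∈ C \ H) (hp : IsGate μ H q p) :
    chainLen μ q p ≤ depth μ C H := by
  obtain ⟨R, hR⟩ := Metric.isBounded_iff.1 hC
  refine le_csSup ⟨L * R, ?_⟩ ⟨q, hq, p, hp, rfl⟩
  rintro _ ⟨q, hq, p, hp, rfl⟩
  exact (chainLen_le h hL _ _).trans (mul_le_mul_of_nonneg_left (hR hq.1 (hHC hp.1)) hL0)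

variable {G : Type*} [Group G] [MulAction G X]

theorem depth_lt_depth [CompleteSpace X] [ConnectedSpace X] (h : IsMedianFn μ)
    (hcont : Continuous fun p : X × X × X => μ p.1 p.2.1 p.2.2) (hL : Rect μ L) (hL0 : 0 < L)
    (hiso : ∀ g : G, Isometry fun x : X => g • x)
    (hequiv : ∀ (g : G) (x y z : X), g • μ x y z = μ (g • x) (g • y) (g • z))
    {C H K : Set X} (hC : Cvx μ C) (hCb : IsBounded C) (hinv : ∀ g : G, ∀ w ∈ C, g • w ∈ C)
    (hHC : H ⊆ C) (hKC : K ⊆ C) (hcov : C ⊆ H ∪ K) (hH : Cvx μ H) (hK : Cvx μ K)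
    (hHc : IsClosed H) (hKc : IsClosed K) (hHn : H.Nonempty) (hKn : K.Nonempty)
    (hCK : (C \ K).Nonempty) {g : G} (hg : ∀ w ∈ H, g • w ∉ H) :
    depth μ C K < depth μ C H := by
  set J : Set X := {w | g⁻¹ • w ∈ H}
  have hJ : Cvx μ J := hH.preimage_smul hequiv g⁻¹
  have hJc : IsClosed J := hHc.preimage (hiso g⁻¹).continuous
  have hJn : J.Nonempty := by
    obtain ⟨w, hw⟩ := hHn
    exact ⟨g • w, by simpa [J] using hw⟩
  have hJC : J ⊆ C := fun w hw => by simpa using hinv g _ (hHC hw)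
  have hJH : ∀ w ∈ J, w ∉ H := fun w hw => by simpa using hg _ hw
  have hdisj : Disjoint H J := Set.disjoint_left.2 fun w hw hw' => hJH w hw' hw
  obtain ⟨η, hη, hdist⟩ := exists_pos_le_dist h hcont hL hL0 hH hJ hHc hJc hHn hJn hdisj
  suffices hs : depth μ C K ≤ depth μ C H - η by linarith
  obtain ⟨q₀, hq₀⟩ := hCK
  obtain ⟨p₀, hp₀⟩ := exists_gate h hcont hL hK hKc hKn q₀
  refine csSup_le ⟨_, q₀, hq₀, p₀, hp₀, rfl⟩ ?_
  rintro _ ⟨q, hq, p, hp, rfl⟩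
  have hpH : p ∈ H := by
    by_contra hpH
    have hm := continuous_med hcont q p
    obtain ⟨w, -, hw, hw'⟩ := isPreconnected_closed_iff.1 (isPreconnected_univ (α := X))
      {w | μ q p w = p} {w | μ q p w ∈ H} (isClosed_eq hm continuous_const)
      (hHc.preimage hm) (fun w _ => by
        rcases hcov (hC q hq.1 p (hKC hp.1) w) with hw | hw
        · exact Or.inr hw
        · refine Or.inl ?_
          have := hp.2 _ hw
          rw [h.1, med_med_left h] at this
          exact this)
      ⟨p, trivial, med_right h _ _⟩ ⟨q, trivial, by
        change μ q p q ∈ H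
        rw [med_outer h]
        exact (hcov hq.1).resolve_right hq.2⟩
    have hw1 : μ q p w = p := hw
    have hw2 : μ q p w ∈ H := hw'
    exact hpH (hw1 ▸ hw2)
  obtain ⟨x, hx⟩ := exists_gate h hcont hL hJ hJc hJn q
  have hxK : x ∈ K := (hcov (hJC hx.1)).resolve_left (hJH x hx.1)
  have h1 := chainLen_add_le h hL (hp.2 x hxK)
  have h2 := (hdist p hpH x hx.1).trans (dist_le_chainLen h hL p x)
  have h3 : g⁻¹ • q ∉ H := fun hqJ => by
    have hqx : q = x := by
      have := hx.2 q hqJ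
      rwa [med_left h] at this
    have h4 := chainLen_le h hL q x
    have h5 := dist_nonneg.trans (dist_le_chainLen h hL q p)
    rw [← hqx] at h1 h2 h4
    rw [dist_self, mul_zero] at h4
    linarith
  have h4 : IsGate μ H (g⁻¹ • q) (g⁻¹ • x) := ⟨hx.1, fun u hu => by
    have := hx.2 (g • u) (by simpa [J] using hu)
    simpa only [hequiv, inv_smul_smul] using congrArg (g⁻¹ • ·) this⟩
  have h5 := le_depth h hL hL0.le hCb hHC ⟨hinv g⁻¹ q hq.1, h3⟩ h4
  have h6 := chainLen_le_map h hL (hiso g⁻¹) (hequiv g⁻¹) q x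
  linarith

/-- A bounded nonempty closed convex invariant set. -/
structure IsInvariantCvx (G : Type*) [Group G] [MulAction G X] (μ : X → X → X → X) (C : Set X) :
    Prop where
  nonempty : C.Nonempty
  isClosed : IsClosed C
  cvx : Cvx μ C
  isBounded : IsBounded C
  smul_mem : ∀ g : G, ∀ w ∈ C, g • w ∈ C

theorem IsInvariantCvx.exists_of_isBounded_orbit (h : IsMedianFn μ)
    (hcont : Continuous fun p : X × X × X => μ p.1 p.2.1 p.2.2) {n : ℕ} (hr : RankLE μ n)
    (hL : Rect μ L) (hL0 : 0 ≤ L) (hiso : ∀ g : G, Isometry fun x : X => g • x)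
    (hequiv : ∀ (g : G) (x y z : X), g • μ x y z = μ (g • x) (g • y) (g • z))
    {x : X} (hx : IsBounded (Set.range fun g : G => g • x)) : ∃ C, IsInvariantCvx G μ C := by
  classical
  have hxA : x ∈ Set.range fun g : G => g • x := ⟨1, one_smul _ _⟩
  refine ⟨closure (hull μ (Set.range fun g : G => g • x)), ⟨x, subset_closure (subset_hull _ hxA)⟩,
    isClosed_closure, (cvx_hull _).closure hcont, (isBounded_hull h hr hL hL0 hx hxA).closure,
    fun g w hw => map_mem_closure (hiso g).continuous hw ?_⟩
  rintro z ⟨F, hF, hFz⟩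
  refine ⟨F.image (g • ·), ?_, fun φ hφ => ?_⟩
  · rw [Finset.coe_image]
    rintro _ ⟨b, hb, rfl⟩
    obtain ⟨k, rfl⟩ := hF hb
    exact ⟨g * k, mul_smul _ _ _⟩
  · obtain ⟨a, ha, e⟩ := hFz (fun w => φ (g • w)) fun a b c => by
      change φ (g • μ a b c) = _
      rw [hequiv, hφ]
    exact ⟨g • a, Finset.mem_image_of_mem _ ha, e⟩

theorem IsInvariantCvx.exists_minimal [CompleteSpace X] (h : IsMedianFn μ)
    (hcont : Continuous fun p : X × X × X => μ p.1 p.2.1 p.2.2) (hL : Rect μ L) (hL0 : 0 ≤ L)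
    {C : Set X} (hC : IsInvariantCvx G μ C) : ∃ D, Minimal (IsInvariantCvx G μ) D := by
  obtain ⟨D, -, hD⟩ := zorn_superset_nonempty {C | IsInvariantCvx G μ C}
    (fun S hS hchain ⟨D, hD⟩ => ⟨⋂₀ S, ⟨sInter_nonempty h hcont hL hL0
        (fun H hH => ⟨(hS hH).cvx, (hS hH).isClosed⟩) (fun H hH K hK => by
          rcases hchain.total hH hK with hHK | hHK
          · rw [Set.inter_eq_left.2 hHK]; exact (hS hH).nonempty
          · rw [Set.inter_eq_right.2 hHK]; exact (hS hK).nonempty) hD (hS hD).isBounded,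
      isClosed_sInter fun H hH => (hS hH).isClosed, Cvx.sInter fun H hH => (hS hH).cvx,
      (hS hD).isBounded.subset (Set.sInter_subset_of_mem hD),
      fun g w hw H hH => (hS hH).smul_mem g w (hw H hH)⟩,
      fun H hH => Set.sInter_subset_of_mem hH⟩) C hC
  exact ⟨D, hD⟩

/-- In a minimal invariant set, every proper closed convex subset is disjoint from one of its
translates. -/
theorem exists_smul_notMem [CompleteSpace X] (h : IsMedianFn μ)
    (hcont : Continuous fun p : X × X × X => μ p.1 p.2.1 p.2.2) (hL : Rect μ L) (hL0 : 0 ≤ L)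
    (hiso : ∀ g : G, Isometry fun x : X => g • x)
    (hequiv : ∀ (g : G) (x y z : X), g • μ x y z = μ (g • x) (g • y) (g • z))
    {C H : Set X} (hC : Minimal (IsInvariantCvx G μ) C) (hHC : H ⊆ C) (hH : Cvx μ H)
    (hHc : IsClosed H) (hne : (C \ H).Nonempty) : ∃ g : G, ∀ w ∈ H, g • w ∉ H := by
  by_contra! hno
  have hHb : IsBounded H := hC.prop.isBounded.subset hHC
  let J : G → Set X := fun g => {w | g • w ∈ H}
  have hJ1 : J 1 = H := by ext w; simp [J]
  have hsub : ⋂₀ Set.range J ⊆ H := fun w hw => hJ1 ▸ hw _ ⟨1, rfl⟩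
  have hJ : ∀ A ∈ Set.range J, Cvx μ A ∧ IsClosed A := by
    rintro _ ⟨g, rfl⟩
    exact ⟨hH.preimage_smul hequiv g, hHc.preimage (hiso g).continuous⟩
  have hinv : IsInvariantCvx G μ (⋂₀ Set.range J) := by
    refine ⟨?_, isClosed_sInter fun A hA => (hJ A hA).2, Cvx.sInter fun A hA => (hJ A hA).1,
      hHb.subset hsub, ?_⟩
    · refine sInter_nonempty h hcont hL hL0 hJ ?_ ⟨1, rfl⟩ (hJ1.symm ▸ hHb)
      rintro _ ⟨g, rfl⟩ _ ⟨k, rfl⟩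
      obtain ⟨w, hw, hw'⟩ := hno (k * g⁻¹)
      refine ⟨g⁻¹ • w, ?_, ?_⟩
      · simpa [J] using hw
      · simpa [J, mul_smul] using hw'
    · rintro g w hw _ ⟨k, rfl⟩
      have : (k * g) • w ∈ H := hw _ ⟨k * g, rfl⟩
      simpa [J, mul_smul] using this
  obtain ⟨w, hwC, hwH⟩ := hne
  exact hwH (hsub (hC.le_of_le hinv (hsub.trans hHC) hwC))

theorem subsingleton_of_minimal [CompleteSpace X] [ConnectedSpace X] (h : IsMedianFn μ)
    (hcont : Continuous fun p : X × X × X => μ p.1 p.2.1 p.2.2) {n : ℕ} (hr : RankLE μ n)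
    (hL : Rect μ L) (hL0 : 0 < L) (hiso : ∀ g : G, Isometry fun x : X => g • x)
    (hequiv : ∀ (g : G) (x y z : X), g • μ x y z = μ (g • x) (g • y) (g • z))
    {C : Set X} (hC : Minimal (IsInvariantCvx G μ) C) : C.Subsingleton := by
  intro x hx y hy
  by_contra hxy
  have hCi := hC.prop
  obtain ⟨H, K, hHC, hKC, hcov, hH, hK, hHc, hKc, hHn, hKn, hCH, hCK⟩ :=
    exists_cover h hcont hr hCi.cvx hCi.isClosed hx hy hxy
  obtain ⟨g, hg⟩ := exists_smul_notMem h hcont hL hL0.le hiso hequiv hC hHC hH hHc hCH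
  obtain ⟨k, hk⟩ := exists_smul_notMem h hcont hL hL0.le hiso hequiv hC hKC hK hKc hCK
  have h1 := depth_lt_depth h hcont hL hL0 hiso hequiv hCi.cvx hCi.isBounded hCi.smul_mem hHC hKC
    hcov hH hK hHc hKc hHn hKn hCK hg
  have h2 := depth_lt_depth h hcont hL hL0 hiso hequiv hCi.cvx hCi.isBounded hCi.smul_mem hKC hHC
    (Set.union_comm H K ▸ hcov) hK hH hKc hHc hKn hHn hCH hk
  exact lt_asymm h1 h2

end FixedPoint

end MedianAlgebra

/-- Let `(X, d, μ)` be a uniformly rectifiable metric median algebra of rank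
at most `n` with `(X, d)` complete and connected, and let a group `G` act on `X` by
isometries preserving `μ`.  If the action has bounded orbits then it has a fixed point. -/
theorem stmt_8 {X : Type*} [MetricSpace X] [CompleteSpace X] [ConnectedSpace X]
    (μ : X → X → X → X)
    (hmed : IsMedianFn μ)
    (hcont : Continuous fun p : X × X × X => μ p.1 p.2.1 p.2.2)
    (n : ℕ) (hrank : RankLE μ n)
    (L : ℝ)
    (hrect : ∀ M : Set X, M.Finite → IsSubalgebra μ M →
      ∀ x y : X, dmuM μ M x y ≤ L * dist x y)
    (G : Type*) [Group G] [MulAction G X]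
    (hiso : ∀ g : G, Isometry fun x : X => g • x)
    (hequiv : ∀ (g : G) (x₁ x₂ x₃ : X), g • μ x₁ x₂ x₃ = μ (g • x₁) (g • x₂) (g • x₃))
    (hbdd : ∀ x : X, Bornology.IsBounded (Set.range fun g : G => g • x)) :
    ∃ x : X, ∀ g : G, g • x = x := by
  obtain ⟨x₀⟩ := (inferInstance : Nonempty X)
  have hL : MedianAlgebra.Rect μ (max L 1) := fun M hM hMs x y =>
    (hrect M hM hMs x y).trans (mul_le_mul_of_nonneg_right (le_max_left _ _) dist_nonneg)
  have hL0 : 0 < max L 1 := zero_lt_one.trans_le (le_max_right _ _)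
  obtain ⟨C₀, hC₀⟩ := MedianAlgebra.IsInvariantCvx.exists_of_isBounded_orbit hmed hcont hrank hL
    hL0.le hiso hequiv (hbdd x₀)
  obtain ⟨C, hC⟩ := hC₀.exists_minimal hmed hcont hL hL0.le
  obtain ⟨x, hx⟩ := hC.prop.nonempty
  exact ⟨x, fun g => MedianAlgebra.subsingleton_of_minimal hmed hcont hrank hL hL0 hiso hequiv hC
    (hC.prop.smul_mem g x hx) hx⟩
end

section
/- Let f : X → Y be a quasi-isometry between metric spaces with quasi-inverse g : Y → X, and let μ be a coarse median on (X, d_X). Then the ternary operation ν(y₁,y₂,y₃) := f(μ(g(y₁), g(y₂), g(y₃))) is a coarse median on (Y, d_Y). -/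
/-- `μ` is a coarse median on `(X, d)` with parameters `(k, h)`. -/
def IsCoarseMedianWith {X : Type*} [MetricSpace X] (μ : X → X → X → X)
    (k : ℝ) (h : ℕ → ℝ) : Prop :=
  0 ≤ k ∧ (∀ i, 0 ≤ h i) ∧ Monotone h ∧
    (∀ x y z x' y' z' : X,
      dist (μ x y z) (μ x' y' z') ≤ k * (dist x x' + dist y y' + dist z z') + h 0) ∧
    ∀ A : Finset X, A.Nonempty →
      ∃ (M : Type) (_ : Fintype M) (μM : M → M → M → M) (lam : M → X) (proj : X → M),
        IsMedianFn μM ∧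
          (∀ a ∈ A, dist a (lam (proj a)) ≤ h A.card) ∧
          ∀ m₁ m₂ m₃ : M,
            dist (lam (μM m₁ m₂ m₃)) (μ (lam m₁) (lam m₂) (lam m₃)) ≤ h A.card

/-- `μ` is a coarse median on `(X, d)`. -/
def IsCoarseMedian {X : Type*} [MetricSpace X] (μ : X → X → X → X) : Prop :=
  ∃ k h, IsCoarseMedianWith μ k h

/-- `f` is a quasi-isometric embedding. -/
def IsQIE {X Y : Type*} [MetricSpace X] [MetricSpace Y] (f : X → Y) : Prop :=
  ∃ α ε : ℝ, 0 < α ∧ 0 ≤ ε ∧ ∀ x x' : X,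
    α⁻¹ * dist x x' - ε ≤ dist (f x) (f x') ∧ dist (f x) (f x') ≤ α * dist x x' + ε

/-- `f` is a quasi-isometry with quasi-inverse `g`. -/
def IsQuasiInverse {X Y : Type*} [MetricSpace X] [MetricSpace Y]
    (f : X → Y) (g : Y → X) : Prop :=
  IsQIE f ∧ IsQIE g ∧ (∃ C, ∀ y, dist (f (g y)) y ≤ C) ∧ ∃ C, ∀ x, dist (g (f x)) x ≤ C

/-- If `f : X → Y` is a quasi-isometry with quasi-inverse `g` and `μ` is a
coarse median on `X`, then `ν(y₁,y₂,y₃) = f(μ(g y₁, g y₂, g y₃))` is a coarse median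
on `Y`. -/
theorem stmt_9 {X Y : Type*} [MetricSpace X] [MetricSpace Y]
    (f : X → Y) (g : Y → X) (hfg : IsQuasiInverse f g)
    (μ : X → X → X → X) (hμ : IsCoarseMedian μ) :
    IsCoarseMedian fun y₁ y₂ y₃ => f (μ (g y₁) (g y₂) (g y₃)) := by
  classical
  obtain ⟨⟨α, ε, hα, hε, hf⟩, ⟨β, δ, hβ, hδ, hg⟩, ⟨C, hC⟩, ⟨D, hD⟩⟩ := hfg
  obtain ⟨k, h, hk, h_nonneg, h_mono, h_lip, h_approx⟩ := hμ
  have hC' : ∀ y, dist y (f (g y)) ≤ |C| := fun y => by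
    rw [dist_comm]
    exact (hC y).trans (le_abs_self C)
  have hD' : ∀ x, dist x (g (f x)) ≤ |D| := fun x => by
    rw [dist_comm]
    exact (hD x).trans (le_abs_self D)
  have hkD : 0 ≤ k * |D| := by positivity
  have hkδ : 0 ≤ k * δ := by positivity
  refine ⟨α * (k * β),
    fun n => α * (h n + h 0 + 3 * (k * |D|) + 3 * (k * δ)) + ε + |C|,
    by positivity, fun n => ?_, fun m n hmn => ?_, fun x y z x' y' z' => ?_, fun A hA => ?_⟩
  · have h1 := h_nonneg n
    have h2 := h_nonneg 0
    positivity
  · have := h_mono hmn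
    dsimp only
    gcongr
  · have hsum : dist (g x) (g x') + dist (g y) (g y') + dist (g z) (g z') ≤
        β * (dist x x' + dist y y' + dist z z') + 3 * δ := by
      linarith [(hg x x').2, (hg y y').2, (hg z z').2]
    have hinner : dist (μ (g x) (g y) (g z)) (μ (g x') (g y') (g z')) ≤
        k * β * (dist x x' + dist y y' + dist z z') +
          (h 0 + h 0 + 3 * (k * |D|) + 3 * (k * δ)) := by
      linarith [h_lip (g x) (g y) (g z) (g x') (g y') (g z'),
        mul_le_mul_of_nonneg_left hsum hk, h_nonneg 0]
    linarith [(hf (μ (g x) (g y) (g z)) (μ (g x') (g y') (g z'))).2,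
      mul_le_mul_of_nonneg_left hinner hα.le, abs_nonneg C]
  · obtain ⟨M, hM, μM, lam, proj, hmed, hproj, hlam⟩ := h_approx (A.image g) (hA.image g)
    have hcard : h (A.image g).card ≤ h A.card := h_mono Finset.card_image_le
    refine ⟨M, hM, μM, fun m => f (lam m), fun y => proj (g y), hmed, fun a ha => ?_,
      fun m₁ m₂ m₃ => ?_⟩
    · have hinner : dist (g a) (lam (proj (g a))) ≤
          h A.card + h 0 + 3 * (k * |D|) + 3 * (k * δ) := by
        linarith [hproj (g a) (Finset.mem_image_of_mem g ha), h_nonneg 0]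
      linarith [dist_triangle a (f (g a)) (f (lam (proj (g a)))), hC' a,
        (hf (g a) (lam (proj (g a)))).2, mul_le_mul_of_nonneg_left hinner hα.le]
    · have hsum : dist (lam m₁) (g (f (lam m₁))) + dist (lam m₂) (g (f (lam m₂))) +
          dist (lam m₃) (g (f (lam m₃))) ≤ 3 * |D| := by
        linarith [hD' (lam m₁), hD' (lam m₂), hD' (lam m₃)]
      have hinner : dist (lam (μM m₁ m₂ m₃))
          (μ (g (f (lam m₁))) (g (f (lam m₂))) (g (f (lam m₃)))) ≤
            h A.card + h 0 + 3 * (k * |D|) + 3 * (k * δ) := by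
        linarith [dist_triangle (lam (μM m₁ m₂ m₃)) (μ (lam m₁) (lam m₂) (lam m₃))
            (μ (g (f (lam m₁))) (g (f (lam m₂))) (g (f (lam m₃)))),
          hlam m₁ m₂ m₃, mul_le_mul_of_nonneg_left hsum hk,
          h_lip (lam m₁) (lam m₂) (lam m₃)
            (g (f (lam m₁))) (g (f (lam m₂))) (g (f (lam m₃)))]
      linarith [(hf (lam (μM m₁ m₂ m₃))
          (μ (g (f (lam m₁))) (g (f (lam m₂))) (g (f (lam m₃))))).2,
        mul_le_mul_of_nonneg_left hinner hα.le, abs_nonneg C]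
end

section
/- Let f : X → Y be a quasi-isometry between metric spaces with quasi-inverse g, and let μ be a coarse median on X of rank at most n. Then the coarse median (y₁,y₂,y₃) ↦ f(μ(g(y₁),g(y₂),g(y₃))) on Y also has rank at most n. -/
/-- `μ` is a coarse median of rank at most `n` on `(X, d)`: parameters `(k, h)` can be
chosen so that all the approximating finite median algebras have rank at most `n`. -/
def IsCoarseMedianRankLE {X : Type*} [MetricSpace X] (μ : X → X → X → X) (n : ℕ) : Prop :=
  ∃ (k : ℝ) (h : ℕ → ℝ),
    0 ≤ k ∧ (∀ i, 0 ≤ h i) ∧ Monotone h ∧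
      (∀ x y z x' y' z' : X,
        dist (μ x y z) (μ x' y' z') ≤ k * (dist x x' + dist y y' + dist z z') + h 0) ∧
      ∀ A : Finset X, A.Nonempty →
        ∃ (M : Type) (_ : Fintype M) (μM : M → M → M → M) (lam : M → X) (proj : X → M),
          IsMedianFn μM ∧ RankLE μM n ∧
            (∀ a ∈ A, dist a (lam (proj a)) ≤ h A.card) ∧
            ∀ m₁ m₂ m₃ : M,
              dist (lam (μM m₁ m₂ m₃)) (μ (lam m₁) (lam m₂) (lam m₃)) ≤ h A.card

/-- If `f : X → Y` is a quasi-isometry with quasi-inverse `g` and `μ` is a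
coarse median on `X` of rank at most `n`, then the pushforward coarse median
`(y₁,y₂,y₃) ↦ f(μ(g y₁, g y₂, g y₃))` on `Y` also has rank at most `n`. -/
theorem stmt_11 {X Y : Type*} [MetricSpace X] [MetricSpace Y]
    (f : X → Y) (g : Y → X) (hfg : IsQuasiInverse f g)
    (μ : X → X → X → X) (n : ℕ) (hμ : IsCoarseMedianRankLE μ n) :
    IsCoarseMedianRankLE (fun y₁ y₂ y₃ => f (μ (g y₁) (g y₂) (g y₃))) n := by
  classical
  obtain ⟨⟨a, e, ha, he, hf⟩, ⟨b, e', hb, he', hg⟩, ⟨C, hC⟩, ⟨C', hC'⟩⟩ := hfg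
  obtain ⟨k, h, hk, hnonneg, hmono, hlip, happrox⟩ := hμ
  have hf_le : ∀ {x x' : X} {r : ℝ}, dist x x' ≤ r → dist (f x) (f x') ≤ a * r + e :=
    fun hr => (hf _ _).2.trans (by gcongr)
  set K : ℝ := h 0 + k * (3 * e') + k * (3 * |C'|) with hK
  have hK0 : 0 ≤ K := by have := hnonneg 0; positivity
  have hK1 : h 0 + k * (3 * e') ≤ K := by
    have : 0 ≤ k * (3 * |C'|) := by positivity
    linarith
  have hK2 : h 0 + k * (3 * |C'|) ≤ K := by
    have : 0 ≤ k * (3 * e') := by positivity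
    linarith
  refine ⟨a * (k * b), fun i => a * (h i + K) + e + |C|, by positivity,
    fun i => ?_, fun i j hij => ?_, fun x y z x' y' z' => ?_, fun A hA => ?_⟩
  · have := hnonneg i
    positivity
  · have := hmono hij
    dsimp only
    gcongr
  · have hgs : dist (g x) (g x') + dist (g y) (g y') + dist (g z) (g z') ≤
        b * (dist x x' + dist y y' + dist z z') + 3 * e' := by
      linarith [(hg x x').2, (hg y y').2, (hg z z').2]
    have hμs : dist (μ (g x) (g y) (g z)) (μ (g x') (g y') (g z')) ≤
        k * b * (dist x x' + dist y y' + dist z z') + (h 0 + K) := by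
      linarith [hlip (g x) (g y) (g z) (g x') (g y') (g z'),
        mul_le_mul_of_nonneg_left hgs hk, hnonneg 0]
    linarith [hf_le hμs, abs_nonneg C]
  · obtain ⟨M, hM, μM, lam, proj, hmed, hrank, hproj, hlam⟩ :=
      happrox (A.image g) (hA.image g)
    have hcard : h (A.image g).card ≤ h A.card := hmono Finset.card_image_le
    refine ⟨M, hM, μM, f ∘ lam, proj ∘ g, hmed, hrank, fun y hy => ?_, fun m₁ m₂ m₃ => ?_⟩
    · have hgy : dist (g y) (lam (proj (g y))) ≤ h A.card + K := by
        linarith [hproj (g y) (Finset.mem_image_of_mem g hy)]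
      have htri := dist_triangle y (f (g y)) (f (lam (proj (g y))))
      rw [dist_comm y (f (g y))] at htri
      simp only [Function.comp_apply]
      linarith [hf_le hgy, hC y, le_abs_self C]
    · have hclose : ∀ m, dist (lam m) (g (f (lam m))) ≤ |C'| := fun m => by
        rw [dist_comm]
        exact (hC' _).trans (le_abs_self _)
      have hsum : dist (lam m₁) (g (f (lam m₁))) + dist (lam m₂) (g (f (lam m₂))) +
          dist (lam m₃) (g (f (lam m₃))) ≤ 3 * |C'| := by
        linarith [hclose m₁, hclose m₂, hclose m₃]
      have hμs : dist (lam (μM m₁ m₂ m₃))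
          (μ (g (f (lam m₁))) (g (f (lam m₂))) (g (f (lam m₃)))) ≤ h A.card + K := by
        linarith [dist_triangle (lam (μM m₁ m₂ m₃)) (μ (lam m₁) (lam m₂) (lam m₃))
            (μ (g (f (lam m₁))) (g (f (lam m₂))) (g (f (lam m₃)))),
          hlam m₁ m₂ m₃, mul_le_mul_of_nonneg_left hsum hk,
          hlip (lam m₁) (lam m₂) (lam m₃) (g (f (lam m₁))) (g (f (lam m₂))) (g (f (lam m₃)))]
      simp only [Function.comp_apply]
      linarith [hf_le hμs, abs_nonneg C]
end

section
/- Let μ : (ℝ²)³ → ℝ² be the coordinatewise median operation, i.e. the i-th coordinate of μ(x,y,z) is the median of the three real numbers xᵢ, yᵢ, zᵢ (equivalently xᵢ + yᵢ + zᵢ − max(xᵢ,yᵢ,zᵢ) − min(xᵢ,yᵢ,zᵢ)), and let A : ℝ² → ℝ² be the rotation by angle π/4 about the origin. Then for every R ≥ 0 there exist x, y, z ∈ ℝ² with ‖μ(Ax, Ay, Az) − A(μ(x,y,z))‖₂ > R, where ‖·‖₂ is the Euclidean norm; in other words, sup_{x,y,z ∈ ℝ²} ‖μ(Ax,Ay,Az)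 − A(μ(x,y,z))‖₂ = ∞. -/
/-- The median of three real numbers. -/
noncomputable def med3 (a b c : ℝ) : ℝ := a + b + c - max a (max b c) - min a (min b c)

/-- The coordinatewise median operation on `ℝ²`. -/
noncomputable def medR2 (x y z : ℝ × ℝ) : ℝ × ℝ :=
  (med3 x.1 y.1 z.1, med3 x.2 y.2 z.2)

/-- Rotation of the plane by the angle `π/4` about the origin. -/
noncomputable def rotQuarterPi (x : ℝ × ℝ) : ℝ × ℝ :=
  (Real.cos (Real.pi / 4) * x.1 - Real.sin (Real.pi / 4) * x.2,
    Real.sin (Real.pi / 4) * x.1 + Real.cos (Real.pi / 4) * x.2)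

/-- The Euclidean norm on `ℝ²`. -/
noncomputable def eucNorm (x : ℝ × ℝ) : ℝ := Real.sqrt (x.1 ^ 2 + x.2 ^ 2)

/-- If `b` lies between `a` and `c`, it is the median. -/
theorem med3_eq_mid {a b c : ℝ} (hab : a ≤ b) (hbc : b ≤ c) : med3 a b c = b := by
  rw [med3, max_eq_right hbc, max_eq_right (hab.trans hbc), min_eq_left hbc, min_eq_left hab]
  ring

theorem med3_swap_right (a b c : ℝ) : med3 a b c = med3 a c b := by
  rw [med3, med3, max_comm b c, min_comm b c]
  ring

/-- For the coordinatewise median `μ` on `ℝ²` and the rotation `A` by `π/4`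
about the origin, `sup_{x,y,z} ‖μ(Ax,Ay,Az) − A(μ(x,y,z))‖₂ = ∞`: for every `R ≥ 0` there
are `x, y, z ∈ ℝ²` with `‖μ(Ax,Ay,Az) − A(μ(x,y,z))‖₂ > R`. -/
theorem stmt_12 :
    ∀ R : ℝ, 0 ≤ R → ∃ x y z : ℝ × ℝ,
      R < eucNorm (medR2 (rotQuarterPi x) (rotQuarterPi y) (rotQuarterPi z) -
        rotQuarterPi (medR2 x y z)) := by
  intro R hR
  set t := R + 1 with ht
  have ht0 : 0 ≤ t := by linarith
  set c := √2 / 2 with hc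
  have hc0 : 0 ≤ c := by positivity
  have hc2 : c ^ 2 = 1 / 2 := by
    rw [hc, div_pow, Real.sq_sqrt (by norm_num)]
    norm_num
  have hct : 0 ≤ c * t := mul_nonneg hc0 ht0
  have hA (a b : ℝ) : rotQuarterPi (a, b) = (c * a - c * b, c * a + c * b) := by
    simp only [rotQuarterPi, Real.cos_pi_div_four, Real.sin_pi_div_four, hc]
  have hmed : medR2 (0, 0) (t, t) (2 * t, 0) = (t, 0) := by
    refine Prod.ext (med3_eq_mid ht0 (by linarith)) ?_
    exact (med3_swap_right _ _ _).trans (med3_eq_mid le_rfl ht0)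
  have hmedA : medR2 (rotQuarterPi (0, 0)) (rotQuarterPi (t, t)) (rotQuarterPi (2 * t, 0)) =
      (0, 2 * (c * t)) := by
    simp only [hA, medR2]
    refine Prod.ext ?_ ?_
    · dsimp only
      rw [med3_eq_mid] <;> linarith
    · dsimp only
      rw [med3_eq_mid] <;> linarith
  refine ⟨(0, 0), (t, t), (2 * t, 0), ?_⟩
  have hnorm : eucNorm ((0, 2 * (c * t)) - (c * t - c * 0, c * t + c * 0)) = t := by
    rw [eucNorm, Real.sqrt_eq_iff_mul_self_eq (by positivity) ht0]
    simp only [Prod.mk_sub_mk]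
    linear_combination (2 * t ^ 2) * hc2
  rw [hmedA, hmed, hA, hnorm]
  linarith
end

section
/- Let X and Y be geodesic metric spaces in which every geodesic triangle is δ-slim, fix K ≥ δ, and let μ_X : X³ → X and μ_Y : Y³ → Y be maps such that for all triples, μ_X(x₁,x₂,x₃) is a K-center of some geodesic triangle with vertices x₁, x₂, x₃, and likewise μ_Y(y₁,y₂,y₃) is a K-center of some geodesic triangle with vertices y₁, y₂, y₃. Let f : X → Y be a quasi-isometry with quasi-inverse g : Y → X. Then sup_{y₁,y₂,y₃ ∈ Y} d( f(μ_X(g(y₁), g(y₂), g(y₃))), μ_Y(y₁,y₂,y₃) ) < ∞; that is, the pushforward of the hyperbolic coarse median of X under f is close to the hyperbolic coarse median of Y. -/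
/-- `S` is a geodesic segment from `x` to `y`: the image of an isometric embedding of
`[0, d(x,y)]` sending the endpoints to `x` and `y`. -/
def IsGeodesicSegment {X : Type*} [MetricSpace X] (x y : X) (S : Set X) : Prop :=
  ∃ γ : ℝ → X, γ 0 = x ∧ γ (dist x y) = y ∧
    (∀ s ∈ Set.Icc (0 : ℝ) (dist x y), ∀ t ∈ Set.Icc (0 : ℝ) (dist x y),
      dist (γ s) (γ t) = |s - t|) ∧
    S = γ '' Set.Icc 0 (dist x y)

/-- A geodesic metric space: any two points are joined by a geodesic segment. -/
def GeodesicSpace (X : Type*) [MetricSpace X] : Prop :=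
  ∀ x y : X, ∃ S : Set X, IsGeodesicSegment x y S

/-- A geodesic triangle with sides `S₁, S₂, S₃` is `δ`-slim: each side lies in the closed
`δ`-neighbourhood of the union of the other two. -/
def SlimTriangle {X : Type*} [MetricSpace X] (δ : ℝ) (S₁ S₂ S₃ : Set X) : Prop :=
  (∀ p ∈ S₁, Metric.infDist p (S₂ ∪ S₃) ≤ δ) ∧
    (∀ p ∈ S₂, Metric.infDist p (S₃ ∪ S₁) ≤ δ) ∧
    ∀ p ∈ S₃, Metric.infDist p (S₁ ∪ S₂) ≤ δ

/-- `m` is a `K`-center of the triangle with sides `S₁, S₂, S₃`: it lies within distance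
`K` of each of the three sides. -/
def IsCenter {X : Type*} [MetricSpace X] (K : ℝ) (m : X) (S₁ S₂ S₃ : Set X) : Prop :=
  Metric.infDist m S₁ ≤ K ∧ Metric.infDist m S₂ ≤ K ∧ Metric.infDist m S₃ ≤ K

/-- Every geodesic triangle in `X` is `δ`-slim. -/
def AllTrianglesSlim (X : Type*) [MetricSpace X] (δ : ℝ) : Prop :=
  ∀ (x y z : X) (S₁ S₂ S₃ : Set X), IsGeodesicSegment x y S₁ → IsGeodesicSegment y z S₂ →
    IsGeodesicSegment z x S₃ → SlimTriangle δ S₁ S₂ S₃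

namespace IsGeodesicSegment

variable {X : Type*} [MetricSpace X] {x y p p' : X} {S : Set X}

theorem symm (h : IsGeodesicSegment x y S) : IsGeodesicSegment y x S := by
  obtain ⟨γ, h0, h1, hd, rfl⟩ := h
  refine ⟨fun t => γ (dist x y - t), by simpa using h1, by simpa [dist_comm y x] using h0, ?_, ?_⟩
  · rw [dist_comm y x]
    intro s hs t ht
    simp only [Set.mem_Icc] at hs ht
    rw [hd _ ⟨by linarith, by linarith⟩ _ ⟨by linarith, by linarith⟩, abs_sub_comm]
    congr 1
    ring
  · rw [dist_comm y x]
    ext z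
    constructor
    · rintro ⟨t, ht, rfl⟩
      exact ⟨dist x y - t, ⟨by linarith [ht.2], by linarith [ht.1]⟩, by simp⟩
    · rintro ⟨t, ht, rfl⟩
      exact ⟨dist x y - t, ⟨by linarith [ht.2], by linarith [ht.1]⟩, rfl⟩

theorem nonempty (h : IsGeodesicSegment x y S) : S.Nonempty := by
  obtain ⟨γ, -, -, -, rfl⟩ := h
  exact ⟨γ 0, 0, ⟨le_rfl, dist_nonneg⟩, rfl⟩

theorem dist_add_dist (h : IsGeodesicSegment x y S) (hp : p ∈ S) :
    dist x p + dist p y = dist x y := by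
  obtain ⟨γ, h0, h1, hd, rfl⟩ := h
  obtain ⟨t, ht, rfl⟩ := hp
  have e1 := hd 0 ⟨le_rfl, dist_nonneg⟩ t ht
  have e2 := hd t ht (dist x y) ⟨dist_nonneg, le_rfl⟩
  rw [h0, zero_sub, abs_neg, abs_of_nonneg ht.1] at e1
  rw [h1, abs_sub_comm, abs_of_nonneg (by linarith [ht.2])] at e2
  linarith

theorem dist_eq (h : IsGeodesicSegment x y S) (hp : p ∈ S) (hp' : p' ∈ S) :
    dist p p' = |dist x p - dist x p'| := by
  obtain ⟨γ, h0, h1, hd, rfl⟩ := h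
  obtain ⟨t, ht, rfl⟩ := hp
  obtain ⟨t', ht', rfl⟩ := hp'
  have e1 := hd 0 ⟨le_rfl, dist_nonneg⟩ t ht
  have e2 := hd 0 ⟨le_rfl, dist_nonneg⟩ t' ht'
  rw [h0, zero_sub, abs_neg, abs_of_nonneg ht.1] at e1
  rw [h0, zero_sub, abs_neg, abs_of_nonneg ht'.1] at e2
  rw [e1, e2, hd t ht t' ht']

theorem exists_dist_le_of_infDist_le (h : IsGeodesicSegment x y S) {K : ℝ} {m : X}
    (hm : Metric.infDist m S ≤ K) : ∃ p ∈ S, dist m p ≤ K + 1 := by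
  obtain ⟨p, hp, hlt⟩ := (Metric.infDist_lt_iff h.nonempty (r := K + 1)).1 (by linarith)
  exact ⟨p, hp, hlt.le⟩

theorem dist_add_dist_le (h : IsGeodesicSegment x y S) {R : ℝ} {m : X} (hp : p ∈ S)
    (hm : dist m p ≤ R) : dist m x + dist m y ≤ dist x y + 2 * R := by
  linarith [h.dist_add_dist hp, dist_triangle m p x, dist_triangle m p y, dist_comm x p]

end IsGeodesicSegment

theorem isGeodesicSegment_image_Icc {X : Type*} [MetricSpace X] {γ : ℝ → X} {ℓ a b : ℝ}
    (hd : ∀ s ∈ Set.Icc (0 : ℝ) ℓ, ∀ t ∈ Set.Icc (0 : ℝ) ℓ, dist (γ s) (γ t) = |s - t|)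
    (ha : 0 ≤ a) (hab : a ≤ b) (hb : b ≤ ℓ) :
    IsGeodesicSegment (γ a) (γ b) (γ '' Set.Icc a b) := by
  have hdist : dist (γ a) (γ b) = b - a := by
    rw [hd a ⟨ha, by linarith⟩ b ⟨by linarith, hb⟩, abs_sub_comm, abs_of_nonneg (by linarith)]
  refine ⟨fun t => γ (a + t), by simp, by simp [hdist], ?_, ?_⟩
  · rw [hdist]
    intro s hs t ht
    simp only [Set.mem_Icc] at hs ht
    rw [hd _ ⟨by linarith, by linarith⟩ _ ⟨by linarith, by linarith⟩]
    congr 1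
    ring
  · rw [hdist]
    ext z
    constructor
    · rintro ⟨t, ht, rfl⟩
      exact ⟨t - a, ⟨by linarith [ht.1], by linarith [ht.2]⟩, by simp⟩
    · rintro ⟨t, ht, rfl⟩
      exact ⟨a + t, ⟨by linarith [ht.1], by linarith [ht.2]⟩, rfl⟩

/-- Two points close to all three sides of a geodesic triangle are close to each other. -/
theorem dist_le_of_near_sides {X : Type*} [MetricSpace X] {x y z m m' : X} {S₁ S₂ S₃ : Set X}
    {R : ℝ} (h₁ : IsGeodesicSegment x y S₁) (h₂ : IsGeodesicSegment y z S₂)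
    (h₃ : IsGeodesicSegment z x S₃)
    (m₁ : ∃ p ∈ S₁, dist m p ≤ R) (m₂ : ∃ p ∈ S₂, dist m p ≤ R) (m₃ : ∃ p ∈ S₃, dist m p ≤ R)
    (m₁' : ∃ p ∈ S₁, dist m' p ≤ R) (m₂' : ∃ p ∈ S₂, dist m' p ≤ R)
    (m₃' : ∃ p ∈ S₃, dist m' p ≤ R) : dist m m' ≤ 7 * R := by
  obtain ⟨p, hp, hmp⟩ := m₁
  obtain ⟨p', hp', hmp'⟩ := m₁'
  obtain ⟨r, hr, hmr⟩ := m₂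
  obtain ⟨r', hr', hmr'⟩ := m₂'
  obtain ⟨s, hs, hms⟩ := m₃
  obtain ⟨s', hs', hms'⟩ := m₃'
  have a1 := h₁.dist_add_dist_le hp hmp
  have a2 := h₂.dist_add_dist_le hr hmr
  have a3 := h₃.dist_add_dist_le hs hms
  have b1 := h₁.dist_add_dist_le hp' hmp'
  have b2 := h₂.dist_add_dist_le hr' hmr'
  have b3 := h₃.dist_add_dist_le hs' hms'
  have c1 := dist_triangle_left x y m
  have c2 := dist_triangle_left y z m
  have c3 := dist_triangle_left z x m
  have d1 := dist_triangle_left x y m'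
  have d2 := dist_triangle_left y z m'
  have d3 := dist_triangle_left z x m'
  have hpp : dist p p' ≤ 5 * R := by
    rw [h₁.dist_eq hp hp', abs_le]
    have e1 := dist_triangle x p m
    have e2 := dist_triangle x m p
    have e3 := dist_triangle x p' m'
    have e4 := dist_triangle x m' p'
    rw [dist_comm x m, dist_comm p m] at *
    rw [dist_comm x m', dist_comm p' m'] at *
    constructor <;> linarith
  linarith [dist_triangle m p m', dist_triangle p p' m', dist_comm p' m']

section Morse

variable {Y : Type*} [MetricSpace Y] {δ A E L : ℝ} {q : ℝ → Y}

theorem AllTrianglesSlim.exists_dist_le (h : AllTrianglesSlim Y δ) {x y z p : Y}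
    {S₁ S₂ S₃ : Set Y} (h₁ : IsGeodesicSegment x y S₁) (h₂ : IsGeodesicSegment x z S₂)
    (h₃ : IsGeodesicSegment z y S₃) (hp : p ∈ S₁) :
    (∃ p' ∈ S₂, dist p p' ≤ δ + 1) ∨ ∃ p' ∈ S₃, dist p p' ≤ δ + 1 := by
  have hs := (h x y z S₁ S₃ S₂ h₁ h₃.symm h₂.symm).1 p hp
  obtain ⟨p', hp', hlt⟩ := (Metric.infDist_lt_iff (h₃.nonempty.inl) (r := δ + 1)).1
    (by linarith)
  rcases hp' with hp' | hp'
  · exact Or.inr ⟨p', hp', hlt.le⟩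
  · exact Or.inl ⟨p', hp', hlt.le⟩

theorem AllTrianglesSlim.nonneg (h : AllTrianglesSlim Y δ) (y : Y) (hgeo : GeodesicSpace Y) :
    0 ≤ δ := by
  obtain ⟨S, hS⟩ := hgeo y y
  obtain ⟨p, hp⟩ := hS.nonempty
  exact Metric.infDist_nonneg.trans ((h y y y S S S hS hS hS).1 p hp)

/-- A geodesic is logarithmically close to any coarsely Lipschitz path joining its endpoints. -/
theorem exists_dist_le_log (hgeo : GeodesicSpace Y) (hslim : AllTrianglesSlim Y δ)
    (hA : 0 ≤ A)
    (hq : ∀ s ∈ Set.Icc 0 L, ∀ t ∈ Set.Icc 0 L, dist (q s) (q t) ≤ A * |s - t| + E)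
    (k : ℕ) : ∀ a ∈ Set.Icc 0 L, ∀ b ∈ Set.Icc 0 L, |a - b| ≤ 2 ^ k →
      ∀ S, IsGeodesicSegment (q a) (q b) S → ∀ p ∈ S,
        ∃ s ∈ Set.Icc 0 L, dist p (q s) ≤ (δ + 1) * k + (A + E) := by
  induction k with
  | zero =>
    intro a ha b hb hab S hS p hp
    refine ⟨a, ha, ?_⟩
    have h1 := hS.dist_add_dist hp
    have h2 := hq a ha b hb
    have h3 : A * |a - b| ≤ A * 1 := mul_le_mul_of_nonneg_left (by simpa using hab) hA
    have h4 := dist_nonneg (x := p) (y := q b)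
    rw [dist_comm p]
    push_cast
    linarith
  | succ k ih =>
    intro a ha b hb hab S hS p hp
    have hc : (a + b) / 2 ∈ Set.Icc 0 L :=
      ⟨by linarith [ha.1, hb.1], by linarith [ha.2, hb.2]⟩
    obtain ⟨S₂, h₂⟩ := hgeo (q a) (q ((a + b) / 2))
    obtain ⟨S₃, h₃⟩ := hgeo (q ((a + b) / 2)) (q b)
    rw [pow_succ, abs_le] at hab
    rcases hslim.exists_dist_le hS h₂ h₃ hp with ⟨p', hp', hd⟩ | ⟨p', hp', hd⟩
    · obtain ⟨s, hs, hsd⟩ := ih a ha _ hc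
        (abs_le.2 ⟨by linarith [hab.1], by linarith [hab.2]⟩) S₂ h₂ p' hp'
      refine ⟨s, hs, ?_⟩
      push_cast
      linarith [dist_triangle p p' (q s), hsd]
    · obtain ⟨s, hs, hsd⟩ := ih _ hc b hb
        (abs_le.2 ⟨by linarith [hab.1], by linarith [hab.2]⟩) S₃ h₃ p' hp'
      refine ⟨s, hs, ?_⟩
      push_cast
      linarith [dist_triangle p p' (q s), hsd]

/-- If a geodesic lies in a neighbourhood of a quasi-geodesic with the same endpoints, and the
radius of this neighbourhood is large, then the radius can be reduced. -/
theorem exists_dist_le_of_succ (hgeo : GeodesicSpace Y) (hslim : AllTrianglesSlim Y δ)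
    (hδ : 0 ≤ δ) (hA : 0 ≤ A) (hE : 0 ≤ E) (hL : 0 ≤ L)
    (hq : ∀ s ∈ Set.Icc 0 L, ∀ t ∈ Set.Icc 0 L, dist (q s) (q t) ≤ A * |s - t| + E)
    (hq' : ∀ s ∈ Set.Icc 0 L, ∀ t ∈ Set.Icc 0 L, |s - t| ≤ A * dist (q s) (q t) + E)
    {S : Set Y} (hS : IsGeodesicSegment (q 0) (q L) S) {k : ℕ}
    (hk : A * (6 * ((δ + 1) * (k + 3) + (A + E))) + E ≤ 2 ^ k)
    (hD : ∀ p ∈ S, ∃ s ∈ Set.Icc 0 L, dist p (q s) ≤ (δ + 1) * (k + 3) + (A + E)) :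
    ∀ p ∈ S, ∃ s ∈ Set.Icc 0 L, dist p (q s) ≤ (δ + 1) * (k + 2) + (A + E) := by
  obtain ⟨γ, h0, h1, hd, rfl⟩ := hS
  rintro _ ⟨τ, hτ, rfl⟩
  set ℓ := dist (q 0) (q L)
  have hk0 : (0 : ℝ) ≤ (δ + 1) * k := by positivity
  have hexp3 : (δ + 1) * ((k : ℝ) + 3) = (δ + 1) * k + 3 * (δ + 1) := by ring
  have hexp2 : (δ + 1) * ((k : ℝ) + 2) = (δ + 1) * k + 2 * (δ + 1) := by ring
  rw [hexp2]
  rw [hexp3] at hk hD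
  set D := (δ + 1) * k + 3 * (δ + 1) + (A + E) with hDdef
  have hDpos : 0 < D := by linarith
  obtain ⟨a, s, ha, haτ, hs, has, hasD, hafar⟩ : ∃ a s, 0 ≤ a ∧ a ≤ τ ∧ s ∈ Set.Icc 0 L ∧
      dist (γ a) (q s) ≤ D ∧ τ - a ≤ 2 * D ∧ (γ a = q s ∨ τ - a = 2 * D) := by
    rcases le_total τ (2 * D) with h | h
    · exact ⟨0, 0, le_rfl, hτ.1, ⟨le_rfl, hL⟩, by simp [h0, hDpos.le], by linarith, Or.inl h0⟩
    · obtain ⟨s, hs, hsD⟩ := hD (γ (τ - 2 * D)) ⟨_, ⟨by linarith, by linarith [hτ.2]⟩, rfl⟩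
      exact ⟨τ - 2 * D, s, by linarith, by linarith, hs, hsD, by linarith, Or.inr (by ring)⟩
  obtain ⟨b, t, hb, hbτ, ht, hbt, hbtD, hbfar⟩ : ∃ b t, b ≤ ℓ ∧ τ ≤ b ∧ t ∈ Set.Icc 0 L ∧
      dist (γ b) (q t) ≤ D ∧ b - τ ≤ 2 * D ∧ (γ b = q t ∨ b - τ = 2 * D) := by
    rcases le_total ℓ (τ + 2 * D) with h | h
    · exact ⟨ℓ, L, le_rfl, hτ.2, ⟨hL, le_rfl⟩, by simp [h1, hDpos.le], by linarith, Or.inl h1⟩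
    · obtain ⟨t, ht, htD⟩ := hD (γ (τ + 2 * D)) ⟨_, ⟨by linarith [hτ.1], by linarith⟩, rfl⟩
      exact ⟨τ + 2 * D, t, by linarith, by linarith, ht, htD, by linarith, Or.inr (by ring)⟩
  have hda : dist (γ a) (γ τ) = τ - a := by
    rw [hd a ⟨ha, by linarith⟩ τ hτ, abs_sub_comm, abs_of_nonneg (by linarith)]
  have hdb : dist (γ b) (γ τ) = b - τ := by
    rw [hd b ⟨by linarith, hb⟩ τ hτ, abs_of_nonneg (by linarith)]
  have near_end : ∀ (u : Y) (r : ℝ) (T : Set Y) (z : Y), IsGeodesicSegment u (q r) T → z ∈ T →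
      dist (γ τ) z ≤ 2 * (δ + 1) → dist u (q r) ≤ D → (u = q r ∨ dist u (γ τ) = 2 * D) →
      dist (γ τ) (q r) ≤ (δ + 1) * k + 2 * (δ + 1) + (A + E) := by
    intro u r T z hT hz hzτ hur hu
    have hadd := hT.dist_add_dist hz
    rcases hu with rfl | hu
    · rw [dist_self] at hadd
      linarith [dist_triangle (γ τ) z (q r), dist_nonneg (x := q r) (y := z)]
    · linarith [dist_triangle u z (γ τ), dist_comm z (γ τ), dist_nonneg (x := z) (y := q r)]
  obtain ⟨T₁, hT₁⟩ := hgeo (γ a) (q s)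
  obtain ⟨T₂, hT₂⟩ := hgeo (q s) (q t)
  obtain ⟨T₃, hT₃⟩ := hgeo (γ b) (q t)
  obtain ⟨T, hT⟩ := hgeo (γ a) (q t)
  rcases hslim.exists_dist_le (isGeodesicSegment_image_Icc hd ha (haτ.trans hbτ) hb) hT hT₃.symm
    ⟨τ, ⟨haτ, hbτ⟩, rfl⟩ with ⟨z, hz, hzd⟩ | ⟨z, hz, hzd⟩
  · rcases hslim.exists_dist_le hT hT₁ hT₂ hz with ⟨z', hz', hzd'⟩ | ⟨z', hz', hzd'⟩
    · exact ⟨s, hs, near_end _ s T₁ z' hT₁ hz' (by linarith [dist_triangle (γ τ) z z']) has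
        (by rwa [hda])⟩
    · have hst : dist (q s) (q t) ≤ 6 * D := by
        have e := dist_triangle4 (q s) (γ a) (γ τ) (q t)
        linarith [dist_comm (q s) (γ a), dist_triangle (γ τ) (γ b) (q t), dist_comm (γ τ) (γ b)]
      have hst' : |s - t| ≤ 2 ^ k :=
        (hq' s hs t ht).trans (le_trans (by gcongr) hk)
      obtain ⟨r, hr, hrd⟩ := exists_dist_le_log hgeo hslim hA hq k s hs t ht hst' T₂ hT₂ z' hz'
      refine ⟨r, hr, ?_⟩
      linarith [dist_triangle4 (γ τ) z z' (q r)]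
  · exact ⟨t, ht, near_end _ t T₃ z hT₃ hz (by linarith) hbt (by rwa [hdb])⟩

theorem exists_forall_linear_le_two_pow (a b : ℝ) :
    ∃ k₀ : ℕ, ∀ k : ℕ, k₀ ≤ k → a * k + b ≤ 2 ^ k := by
  have h1 : Filter.Tendsto (fun k : ℕ => a * ((k : ℝ) ^ 1 / 2 ^ k) + b * ((k : ℝ) ^ 0 / 2 ^ k))
      Filter.atTop (nhds (a * 0 + b * 0)) :=
    ((tendsto_pow_const_div_const_pow_of_one_lt 1 one_lt_two).const_mul a).add
      ((tendsto_pow_const_div_const_pow_of_one_lt 0 one_lt_two).const_mul b)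
  have h2 := h1.eventually (gt_mem_nhds (show a * 0 + b * 0 < 1 by norm_num))
  obtain ⟨k₀, hk₀⟩ := Filter.eventually_atTop.1 h2
  refine ⟨k₀, fun k hk => ?_⟩
  have h3 := hk₀ k hk
  have h4 : a * ((k : ℝ) ^ 1 / 2 ^ k) + b * ((k : ℝ) ^ 0 / 2 ^ k) = (a * k + b) / 2 ^ k := by
    ring
  rw [h4, div_lt_one (by positivity)] at h3
  exact h3.le

/-- Geodesics are uniformly close to quasi-geodesics with the same endpoints. -/
theorem exists_geodesic_near_quasiGeodesic (hgeo : GeodesicSpace Y)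
    (hslim : AllTrianglesSlim Y δ) (hδ : 0 ≤ δ) (hA : 0 ≤ A) (hE : 0 ≤ E) :
    ∃ D, 0 ≤ D ∧ ∀ (q : ℝ → Y) (L : ℝ), 0 ≤ L →
      (∀ s ∈ Set.Icc 0 L, ∀ t ∈ Set.Icc 0 L, dist (q s) (q t) ≤ A * |s - t| + E) →
      (∀ s ∈ Set.Icc 0 L, ∀ t ∈ Set.Icc 0 L, |s - t| ≤ A * dist (q s) (q t) + E) →
      ∀ S, IsGeodesicSegment (q 0) (q L) S → ∀ p ∈ S, ∃ s ∈ Set.Icc 0 L, dist p (q s) ≤ D := by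
  obtain ⟨k₀, hk₀⟩ := exists_forall_linear_le_two_pow (A * (6 * (δ + 1)))
    (A * (6 * ((δ + 1) * 3 + (A + E))) + E)
  refine ⟨(δ + 1) * (k₀ + 2) + (A + E), by positivity, fun q L hL hq hq' S hS => ?_⟩
  have descend : ∀ j : ℕ,
      (∀ p ∈ S, ∃ s ∈ Set.Icc 0 L, dist p (q s) ≤ (δ + 1) * ((k₀ + j : ℕ) + 2) + (A + E)) →
      ∀ p ∈ S, ∃ s ∈ Set.Icc 0 L, dist p (q s) ≤ (δ + 1) * (k₀ + 2) + (A + E) := by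
    intro j
    induction j with
    | zero => exact id
    | succ j ih =>
      intro h
      refine ih (exists_dist_le_of_succ hgeo hslim hδ hA hE hL hq hq' hS ?_ ?_)
      · refine le_trans (le_of_eq ?_) (hk₀ (k₀ + j) (Nat.le_add_right _ _))
        ring
      · intro p hp
        obtain ⟨s, hs, hsd⟩ := h p hp
        refine ⟨s, hs, hsd.trans (le_of_eq ?_)⟩
        push_cast
        ring
  obtain ⟨j, hj⟩ := pow_unbounded_of_one_lt L (one_lt_two (α := ℝ))
  refine descend j fun p hp => ?_
  have hL' : |0 - L| ≤ 2 ^ (k₀ + j) := by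
    rw [zero_sub, abs_neg, abs_of_nonneg hL]
    exact hj.le.trans (pow_le_pow_right₀ one_le_two (Nat.le_add_left _ _))
  obtain ⟨s, hs, hsd⟩ := exists_dist_le_log hgeo hslim hA hq (k₀ + j) 0 ⟨le_rfl, hL⟩ L
    ⟨hL, le_rfl⟩ hL' S hS p hp
  refine ⟨s, hs, hsd.trans ?_⟩
  gcongr
  linarith

/-- Quasi-geodesics are uniformly close to geodesics with the same endpoints. -/
theorem exists_quasiGeodesic_near_geodesic (hgeo : GeodesicSpace Y)
    (hslim : AllTrianglesSlim Y δ) (hδ : 0 ≤ δ) (hA : 0 ≤ A) (hE : 0 ≤ E) :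
    ∃ R, ∀ (q : ℝ → Y) (L : ℝ), 0 ≤ L →
      (∀ s ∈ Set.Icc 0 L, ∀ t ∈ Set.Icc 0 L, dist (q s) (q t) ≤ A * |s - t| + E) →
      (∀ s ∈ Set.Icc 0 L, ∀ t ∈ Set.Icc 0 L, |s - t| ≤ A * dist (q s) (q t) + E) →
      ∀ S, IsGeodesicSegment (q 0) (q L) S → ∀ t ∈ Set.Icc 0 L, ∃ p ∈ S, dist (q t) p ≤ R := by
  obtain ⟨D, hD0, hD⟩ := exists_geodesic_near_quasiGeodesic hgeo hslim hδ hA hE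
  refine ⟨A * (A * (2 * D + 2) + E) + E + D, fun q L hL hq hq' S hS t ht => ?_⟩
  have hnear := hD q L hL hq hq' S hS
  obtain ⟨γ, h0, h1, hd, rfl⟩ := hS
  set ℓ := dist (q 0) (q L)
  have hℓ : 0 ≤ ℓ := dist_nonneg
  let B : Set ℝ := {τ | τ ∈ Set.Icc 0 ℓ ∧ ∃ s ∈ Set.Icc 0 L, s ≤ t ∧ dist (γ τ) (q s) ≤ D}
  have hB0 : (0 : ℝ) ∈ B :=
    ⟨⟨le_rfl, hℓ⟩, 0, ⟨le_rfl, hL⟩, ht.1, by simpa [h0] using hD0⟩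
  have hBdd : BddAbove B := ⟨ℓ, fun τ hτ => hτ.1.2⟩
  obtain ⟨τ, ⟨hτ, s, hs, hst, hsD⟩, hτB⟩ :=
    exists_lt_of_lt_csSup ⟨0, hB0⟩ (show sSup B - 1 < sSup B by linarith)
  obtain ⟨τ', hτ', hττ', s', hs', hst', hsD'⟩ : ∃ τ' ∈ Set.Icc 0 ℓ, |τ - τ'| ≤ 2 ∧
      ∃ s' ∈ Set.Icc 0 L, t ≤ s' ∧ dist (γ τ') (q s') ≤ D := by
    have hτle : τ ≤ sSup B := le_csSup hBdd ⟨hτ, s, hs, hst, hsD⟩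
    rcases le_or_gt ℓ (sSup B + 1) with h | h
    · exact ⟨ℓ, ⟨hℓ, le_rfl⟩, abs_le.2 ⟨by linarith, by linarith [hτ.2]⟩, L, ⟨hL, le_rfl⟩, ht.2,
        by simpa [h1] using hD0⟩
    · have hmem : sSup B + 1 ∈ Set.Icc 0 ℓ := ⟨by linarith [hτ.1], h.le⟩
      obtain ⟨s', hs', hsD'⟩ := hnear _ ⟨_, hmem, rfl⟩
      refine ⟨_, hmem, abs_le.2 ⟨by linarith, by linarith⟩, s', hs', ?_, hsD'⟩
      by_contra! hlt
      have := le_csSup hBdd (show sSup B + 1 ∈ B from ⟨hmem, s', hs', hlt.le, hsD'⟩)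
      linarith
  refine ⟨γ τ, ⟨τ, hτ, rfl⟩, ?_⟩
  have hss : dist (q s) (q s') ≤ 2 * D + 2 := by
    have e := dist_triangle4 (q s) (γ τ) (γ τ') (q s')
    rw [hd τ hτ τ' hτ', dist_comm (q s) (γ τ)] at e
    linarith
  have hss' : |s - s'| ≤ A * (2 * D + 2) + E := (hq' s hs s' hs').trans (by gcongr)
  have hts : |t - s| ≤ |s - s'| := by
    rw [abs_of_nonneg (by linarith), abs_sub_comm, abs_of_nonneg (by linarith)]
    linarith
  have hqts : dist (q t) (q s) ≤ A * (A * (2 * D + 2) + E) + E :=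
    (hq t ht s hs).trans (by gcongr; exact hts.trans hss')
  linarith [dist_triangle (q t) (q s) (γ τ), dist_comm (q s) (γ τ)]

end Morse

/-- A quasi-isometric embedding sends points near a geodesic to points near any geodesic whose
endpoints are close to the images of the original endpoints. -/
theorem IsQIE.exists_dist_le_of_near_geodesic {X Y : Type*} [MetricSpace X] [MetricSpace Y]
    {δ : ℝ} {f : X → Y} (hf : IsQIE f) (hgeo : GeodesicSpace Y) (hslim : AllTrianglesSlim Y δ)
    (hδ : 0 ≤ δ) (K C : ℝ) (hC : 0 ≤ C) :
    ∃ R, ∀ (a b m : X) (a' b' : Y) (S : Set X) (T : Set Y), IsGeodesicSegment a b S →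
      IsGeodesicSegment a' b' T → dist (f a) a' ≤ C → dist (f b) b' ≤ C →
      Metric.infDist m S ≤ K → ∃ p ∈ T, dist (f m) p ≤ R := by
  obtain ⟨α, ε, hα, hε, hf⟩ := hf
  have hlow : ∀ x x' : X, dist x x' ≤ α * dist (f x) (f x') + α * ε := by
    intro x x'
    have h := mul_le_mul_of_nonneg_left (hf x x').1 hα.le
    rw [mul_sub, mul_inv_cancel_left₀ hα.ne'] at h
    linarith
  have hE : 0 ≤ ε + 2 * C + α * (ε + 2 * C) := by positivity
  obtain ⟨R, hR⟩ := exists_quasiGeodesic_near_geodesic hgeo hslim hδ hα.le hE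
  refine ⟨α * (K + 1) + ε + C + max R (2 * C), fun a b m a' b' S T hS hT ha hb hm => ?_⟩
  obtain ⟨p, hp, hmp⟩ := hS.exists_dist_le_of_infDist_le hm
  obtain ⟨γ, h0, h1, hd, rfl⟩ := hS
  obtain ⟨t, ht, rfl⟩ := hp
  rcases eq_or_ne (dist a b) 0 with hab | hab
  · obtain ⟨r, hr⟩ := hT.nonempty
    have hat : f (γ t) = f a := by
      rw [show t = 0 by linarith [ht.1, ht.2], h0]
    have hab' : dist a' b' ≤ 2 * C := by
      rw [dist_eq_zero.1 hab] at ha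
      linarith [dist_triangle_left a' b' (f b)]
    refine ⟨r, hr, ?_⟩
    have e1 := (hf m (γ t)).2
    have e2 : α * dist m (γ t) ≤ α * (K + 1) := by gcongr
    rw [hat] at e1
    linarith [dist_triangle4 (f m) (f a) a' r, hT.dist_add_dist hr, le_max_right R (2 * C),
      dist_nonneg (x := r) (y := b')]
  let q : ℝ → Y := fun s => if s = 0 then a' else if s = dist a b then b' else f (γ s)
  have hqf : ∀ s, dist (f (γ s)) (q s) ≤ C := by
    intro s
    simp only [q]
    split_ifs with hs hs'
    · rwa [hs, h0]
    · rwa [hs', h1]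
    · simpa using hC
  have hq0 : q 0 = a' := by simp [q]
  have hq1 : q (dist a b) = b' := by simp [q, hab]
  have hclose : ∀ s u, |dist (q s) (q u) - dist (f (γ s)) (f (γ u))| ≤ 2 * C := by
    intro s u
    have e1 := dist_triangle4 (q s) (f (γ s)) (f (γ u)) (q u)
    have e2 := dist_triangle4 (f (γ s)) (q s) (q u) (f (γ u))
    rw [abs_le]
    constructor <;> linarith [hqf s, hqf u, dist_comm (q s) (f (γ s)), dist_comm (q u) (f (γ u))]
  obtain ⟨r, hr, hrd⟩ := hR q (dist a b) dist_nonneg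
    (by
      intro s hs u hu
      have e := (hf (γ s) (γ u)).2
      rw [hd s hs u hu] at e
      have : 0 ≤ α * (ε + 2 * C) := by positivity
      linarith [(abs_le.1 (hclose s u)).2])
    (by
      intro s hs u hu
      have e := hlow (γ s) (γ u)
      rw [hd s hs u hu] at e
      have := mul_le_mul_of_nonneg_left (abs_le.1 (hclose s u)).1 hα.le
      linarith)
    T (by rwa [hq0, hq1]) t ht
  refine ⟨r, hr, ?_⟩
  have e1 := (hf m (γ t)).2
  have e2 : α * dist m (γ t) ≤ α * (K + 1) := by gcongr
  linarith [dist_triangle4 (f m) (f (γ t)) (q t) r, hqf t, le_max_left R (2 * C)]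

/-- Let `X, Y` be geodesic spaces all of whose geodesic triangles are
`δ`-slim, `K ≥ δ`, and let `μ_X`, `μ_Y` assign to each triple of points a `K`-center of
some geodesic triangle on these vertices.  If `f : X → Y` is a quasi-isometry with
quasi-inverse `g`, then the pushforward of `μ_X` under `f` is close to `μ_Y`. -/
theorem stmt_15 {X Y : Type*} [MetricSpace X] [MetricSpace Y] (δ K : ℝ) (hδK : δ ≤ K)
    (hXgeo : GeodesicSpace X) (hXslim : AllTrianglesSlim X δ)
    (hYgeo : GeodesicSpace Y) (hYslim : AllTrianglesSlim Y δ)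
    (μX : X → X → X → X) (μY : Y → Y → Y → Y)
    (hμX : ∀ x₁ x₂ x₃ : X, ∃ S₁ S₂ S₃ : Set X,
      IsGeodesicSegment x₁ x₂ S₁ ∧ IsGeodesicSegment x₂ x₃ S₂ ∧ IsGeodesicSegment x₃ x₁ S₃ ∧
        IsCenter K (μX x₁ x₂ x₃) S₁ S₂ S₃)
    (hμY : ∀ y₁ y₂ y₃ : Y, ∃ S₁ S₂ S₃ : Set Y,
      IsGeodesicSegment y₁ y₂ S₁ ∧ IsGeodesicSegment y₂ y₃ S₂ ∧ IsGeodesicSegment y₃ y₁ S₃ ∧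
        IsCenter K (μY y₁ y₂ y₃) S₁ S₂ S₃)
    (f : X → Y) (g : Y → X) (hfg : IsQuasiInverse f g) :
    ∃ C : ℝ, ∀ y₁ y₂ y₃ : Y,
      dist (f (μX (g y₁) (g y₂) (g y₃))) (μY y₁ y₂ y₃) ≤ C := by
  rcases isEmpty_or_nonempty Y with hY | ⟨⟨y₀⟩⟩
  · exact ⟨0, fun y => hY.elim y⟩
  have hδ := hYslim.nonneg y₀ hYgeo
  obtain ⟨hf, -, ⟨C, hC⟩, -⟩ := hfg
  obtain ⟨R, hR⟩ := hf.exists_dist_le_of_near_geodesic hYgeo hYslim hδ K C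
    (dist_nonneg.trans (hC y₀))
  refine ⟨7 * max R (K + 1), fun y₁ y₂ y₃ => ?_⟩
  obtain ⟨S₁, S₂, S₃, hS₁, hS₂, hS₃, c₁, c₂, c₃⟩ := hμX (g y₁) (g y₂) (g y₃)
  obtain ⟨T₁, T₂, T₃, hT₁, hT₂, hT₃, d₁, d₂, d₃⟩ := hμY y₁ y₂ y₃
  have near : ∀ {x x' : Y} {S : Set X} {T : Set Y}, IsGeodesicSegment (g x) (g x') S →
      IsGeodesicSegment x x' T → Metric.infDist (μX (g y₁) (g y₂) (g y₃)) S ≤ K →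
      ∃ p ∈ T, dist (f (μX (g y₁) (g y₂) (g y₃))) p ≤ max R (K + 1) := by
    intro x x' S T hS hT hm
    obtain ⟨p, hp, hpd⟩ := hR _ _ _ _ _ S T hS hT (hC x) (hC x') hm
    exact ⟨p, hp, hpd.trans (le_max_left _ _)⟩
  have near' : ∀ {x x' : Y} {T : Set Y}, IsGeodesicSegment x x' T →
      Metric.infDist (μY y₁ y₂ y₃) T ≤ K →
      ∃ p ∈ T, dist (μY y₁ y₂ y₃) p ≤ max R (K + 1) := by
    intro x x' T hT hm
    obtain ⟨p, hp, hpd⟩ := hT.exists_dist_le_of_infDist_le hm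
    exact ⟨p, hp, hpd.trans (le_max_right _ _)⟩
  exact dist_le_of_near_sides hT₁ hT₂ hT₃ (near hS₁ hT₁ c₁) (near hS₂ hT₂ c₂) (near hS₃ hT₃ c₃)
    (near' hT₁ d₁) (near' hT₂ d₂) (near' hT₃ d₃)
end

section
/- Let G be a group with finite generating set S and word metric d_S, and let H be a group with finite generating set T. For a homomorphism φ : H → G let l_φ(g) = max_{t ∈ T} d_S(φ(t)·g, g) and λ_φ = min_{g ∈ G} l_φ(g) (the minimum exists since l_φ takes values in ℕ). If (φ_n)_{n ∈ ℕ} is a sequence of homomorphisms H → G that are pairwise non-conjugate (i.e. for m ≠ n there is no g ∈ G with φ_m(h) = g·φ_n(h)·g⁻¹ for all h ∈ H), then λ_{φ_n} → ∞ as n → ∞. -/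
/-- The word length of `g` with respect to the finite generating set `S`: the least length
of a word in `S ∪ S⁻¹` representing `g`.  The word metric is
`d_S(g, g') = wordLength S (g⁻¹ * g')`. -/
noncomputable def wordLength {G : Type*} [Group G] (S : Finset G) (g : G) : ℕ :=
  sInf {n | ∃ w : List G, w.length = n ∧ (∀ x ∈ w, x ∈ S ∨ x⁻¹ ∈ S) ∧ w.prod = g}

/-- `l_φ(g) = max_{t ∈ T} d_S(φ(t)·g, g)`. -/
noncomputable def lPhi {G H : Type*} [Group G] [Group H] (S : Finset G) (T : Finset H)
    (φ : H →* G) (g : G) : ℕ :=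
  T.sup fun t => wordLength S ((φ t * g)⁻¹ * g)

/-- `λ_φ = min_{g ∈ G} l_φ(g)` (the minimum of a set of naturals, via `sInf`). -/
noncomputable def lambdaPhi {G H : Type*} [Group G] [Group H] (S : Finset G) (T : Finset H)
    (φ : H →* G) : ℕ :=
  sInf (Set.range (lPhi S T φ))

theorem exists_word_of_closure_eq_top {G : Type*} [Group G] (S : Finset G)
    (hS : Subgroup.closure (S : Set G) = ⊤) (g : G) :
    ∃ w : List G, w.length = wordLength S g ∧ (∀ x ∈ w, x ∈ S ∨ x⁻¹ ∈ S) ∧ w.prod = g := by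
  have hg : g ∈ Subgroup.closure (S : Set G) := hS ▸ Subgroup.mem_top g
  rw [← Subgroup.mem_toSubmonoid, Subgroup.closure_toSubmonoid] at hg
  obtain ⟨w, hw, hprod⟩ := Submonoid.exists_list_of_mem_closure hg
  exact Nat.sInf_mem
    (s := {n | ∃ w : List G, w.length = n ∧ (∀ x ∈ w, x ∈ S ∨ x⁻¹ ∈ S) ∧ w.prod = g})
    ⟨w.length, w, rfl, hw, hprod⟩

theorem finite_setOf_wordLength_le {G : Type*} [Group G] (S : Finset G)
    (hS : Subgroup.closure (S : Set G) = ⊤) (n : ℕ) : {g : G | wordLength S g ≤ n}.Finite := by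
  have hA : {x : G | x ∈ S ∨ x⁻¹ ∈ S}.Finite :=
    S.finite_toSet.union (S.finite_toSet.preimage inv_injective.injOn)
  have := hA.to_subtype
  refine ((List.finite_length_le {x : G | x ∈ S ∨ x⁻¹ ∈ S} n).image
    fun l => (l.map Subtype.val).prod).subset fun g hg => ?_
  obtain ⟨w, hlen, hw, hprod⟩ := exists_word_of_closure_eq_top S hS g
  lift w to List {x : G | x ∈ S ∨ x⁻¹ ∈ S} using hw
  refine ⟨w, ?_, hprod⟩
  rw [List.length_map] at hlen
  exact hlen.trans_le hg

theorem exists_lPhi_eq_lambdaPhi {G H : Type*} [Group G] [Group H] (S : Finset G) (T : Finset H)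
    (φ : H →* G) : ∃ g : G, lPhi S T φ g = lambdaPhi S T φ :=
  Nat.sInf_mem (Set.range_nonempty (lPhi S T φ))

/-- Let `G` be a group with finite generating set `S` and word metric `d_S`,
and `H` a group with finite generating set `T`.  If `(φ_n)` is a sequence of pairwise
non-conjugate homomorphisms `H → G`, then `λ_{φ_n} → ∞`. -/
theorem stmt_16 {G H : Type*} [Group G] [Group H]
    (S : Finset G) (hS : Subgroup.closure (S : Set G) = ⊤)
    (T : Finset H) (hT : Subgroup.closure (T : Set H) = ⊤)
    (φ : ℕ → H →* G)
    (hnc : ∀ m n : ℕ, m ≠ n → ¬∃ g : G, ∀ h : H, φ m h = g * φ n h * g⁻¹) :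
    Filter.Tendsto (fun n => lambdaPhi S T (φ n)) Filter.atTop Filter.atTop := by
  choose g hg using fun n => exists_lPhi_eq_lambdaPhi S T (φ n)
  refine Filter.tendsto_atTop.2 fun b => ?_
  rw [← Nat.cofinite_eq_atTop, Filter.eventually_cofinite]
  have hfin : (Set.univ.pi fun _ : T => {x : G | wordLength S x ≤ b}).Finite :=
    Set.Finite.pi fun _ => finite_setOf_wordLength_le S hS b
  have hinj : Function.Injective fun n => fun t : T => (φ n t * g n)⁻¹ * g n := by
    intro m n hmn
    by_contra hne
    refine hnc m n hne ⟨g m * (g n)⁻¹, fun h => ?_⟩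
    have hEq : φ m = (MulAut.conj (g m * (g n)⁻¹)).toMonoidHom.comp (φ n) := by
      refine MonoidHom.eq_of_eqOn_dense hT fun t ht => ?_
      have htt := congrArg (fun x => g m * x⁻¹ * (g m)⁻¹) (congrFun hmn ⟨t, ht⟩)
      simpa [mul_assoc] using htt
    simpa [mul_assoc] using DFunLike.congr_fun hEq h
  refine (hfin.preimage hinj.injOn).subset fun n hn t _ => ?_
  have hle : wordLength S ((φ n t * g n)⁻¹ * g n) ≤ lPhi S T (φ n) (g n) :=
    Finset.le_sup (f := fun t => wordLength S ((φ n t * g n)⁻¹ * g n)) t.2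
  exact hle.trans ((hg n).trans_le (not_le.1 hn).le)
end

section
/- For every k ≥ 0, every non-decreasing h : ℕ → ℝ≥0, and every n ∈ ℕ, there exist functions α, ε : ℕ → ℝ≥0 (depending only on k, h, n) such that the following holds. Let (X, d) be a metric space with a coarse median μ with parameters (k, h). Then for each finite subset A ⊆ X there exist a finite median metric space (M, d_M) and an (α(|A|), ε(|A|))-quasi-isometric embedding F : (M, d_M) → (X, d) with A ⊆ F(M). Moreover, if μ has rank at most n with parameters (k, h), then M can always be chosen so that its intrinsic median algebra has rank at most n+1. -/
universe u

/-- `μ` is a coarse median with parameters `(k, h)` of rank at most `n`: all the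
approximating finite median algebras can be taken of rank at most `n`. -/
def IsCoarseMedianWithRank {X : Type*} [MetricSpace X] (μ : X → X → X → X)
    (k : ℝ) (h : ℕ → ℝ) (n : ℕ) : Prop :=
  0 ≤ k ∧ (∀ i, 0 ≤ h i) ∧ Monotone h ∧
    (∀ x y z x' y' z' : X,
      dist (μ x y z) (μ x' y' z') ≤ k * (dist x x' + dist y y' + dist z z') + h 0) ∧
    ∀ A : Finset X, A.Nonempty →
      ∃ (M : Type) (_ : Fintype M) (μM : M → M → M → M) (lam : M → X) (proj : X → M),
        IsMedianFn μM ∧ RankLE μM n ∧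
          (∀ a ∈ A, dist a (lam (proj a)) ≤ h A.card) ∧
          ∀ m₁ m₂ m₃ : M,
            dist (lam (μM m₁ m₂ m₃)) (μ (lam m₁) (lam m₂) (lam m₃)) ≤ h A.card

/-- The majority operation of three Booleans. -/
def boolMaj (a b c : Bool) : Bool := (a && b) || (b && c) || (c && a)

/-- A two-valued homomorphism (equivalently, an oriented wall) of a median algebra. -/
def IsBoolHom {M : Type*} (m : M → M → M → M) (φ : M → Bool) : Prop :=
  ∀ a b c, φ (m a b c) = boolMaj (φ a) (φ b) (φ c)

namespace IsMedianFn

variable {M : Type*} {m : M → M → M → M}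

lemma swap (hm : IsMedianFn m) (x y z : M) : m x y z = m x z y := hm.1 x y z

lemma rotate (hm : IsMedianFn m) (x y z : M) : m x y z = m y z x := hm.2.1 x y z

lemma left_left (hm : IsMedianFn m) (x y : M) : m x x y = x := hm.2.2.1 x y

lemma left_right (hm : IsMedianFn m) (x y : M) : m x y x = x := by
  rw [hm.swap, hm.left_left]

lemma right_right (hm : IsMedianFn m) (x y : M) : m y x x = x := by
  rw [hm.rotate, hm.left_left]

lemma between_trans (hm : IsMedianFn m) {y s t z : M} (hs : m y s t = s) (ht : m y t z = t) :
    m y s z = s := by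
  have h := hm.2.2.2 s t y y z
  have e1 : m s t y = s := by rw [← hm.rotate, hs]
  have e2 : m t y z = t := by rw [hm.rotate, hm.swap, ht]
  rw [e1, e2, hm.left_left, e1] at h
  rw [hm.rotate, hm.swap, h]

/-- Projection to an interval is idempotent. -/
lemma proj_proj (hm : IsMedianFn m) (a y z : M) : m (m a y z) y z = m a y z := by
  rw [hm.2.2.2, hm.left_left, hm.rotate z, hm.right_right]

/-- Projection to an interval is a homomorphism. -/
lemma proj_median (hm : IsMedianFn m) (a b c y z : M) :
    m (m a b c) y z = m (m a y z) (m b y z) (m c y z) := by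
  rw [← hm.proj_proj (m a b c), hm.2.2.2 a b c, hm.rotate a, hm.2.2.2, hm.proj_proj,
    ← hm.rotate (m a y z)]

/-- Two distinct points of a finite median algebra are separated by a two-valued homomorphism. -/
lemma exists_separating [Finite M] (hm : IsMedianFn m) {x y : M} (hxy : x ≠ y) :
    ∃ φ, IsBoolHom m φ ∧ φ x ≠ φ y := by
  classical
  obtain ⟨z, ⟨hzx, hzy⟩, hmin⟩ := Set.exists_min_image {z : M | m y z x = z ∧ z ≠ y}
    (fun z => {t | m y t z = t}.ncard) (Set.toFinite _) ⟨x, hm.right_right x y, hxy⟩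
  have key : ∀ t, m y t z = t → t = y ∨ t = z := by
    intro t ht
    by_contra! hne
    have h1 := hmin t ⟨hm.between_trans ht hzx, hne.1⟩
    have h2 : {s | m y s t = s} ⊂ {s | m y s z = s} := by
      refine ⟨fun s hs => hm.between_trans hs ht, fun hsub => hne.2 ?_⟩
      have h3 : m y z t = z := hsub (hm.right_right z y)
      rw [← h3, hm.swap, ht]
    exact absurd (Set.ncard_lt_ncard h2 (Set.toFinite _)) (not_lt.mpr h1)
  have hp : ∀ a, m a y z = y ∨ m a y z = z := fun a => by
    apply key
    rw [hm.swap, ← hm.rotate, hm.proj_proj]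
  refine ⟨fun a => decide (m a y z = z), fun a b c => ?_, ?_⟩
  · simp only [hm.proj_median a b c]
    rcases hp a with ha | ha <;> rcases hp b with hb | hb <;> rcases hp c with hc | hc <;>
      simp [ha, hb, hc, boolMaj, hm.left_left, hm.left_right, hm.right_right, hzy.symm]
  · have : m x y z = z := by rw [hm.rotate, hzx]
    simp [this, hm.left_left, hzy.symm]

end IsMedianFn

lemma IsBoolHom.eq_of_between {M : Type*} {m : M → M → M → M} {φ : M → Bool}
    (hφ : IsBoolHom m φ) {x y z : M} (hz : m x y z = z) (hxy : φ x = φ y) : φ z = φ x := by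
  rw [← hz, hφ]
  cases hx : φ x <;> cases hy : φ z <;> simp_all [boolMaj]

lemma wallDist_term_triangle {M ι : Type*} {φ : ι → M → Bool} {w : ι → ℝ}
    (hw : ∀ i, 0 < w i) (x y z : M) (i : ι) :
    (if φ i x = φ i z then 0 else w i) ≤
      (if φ i x = φ i y then 0 else w i) + (if φ i y = φ i z then 0 else w i) := by
  have := hw i
  split_ifs <;> first | linarith | simp_all

/-- The sum of the weights of the two-valued homomorphisms separating two points. -/
noncomputable def wallDist {M ι : Type*} [Fintype ι] (φ : ι → M → Bool) (w : ι → ℝ)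
    (x y : M) : ℝ :=
  ∑ i, if φ i x = φ i y then 0 else w i

section wallDist

variable {M ι : Type*} [Fintype ι] {φ : ι → M → Bool} {w : ι → ℝ}

lemma wallDist_self (x : M) : wallDist φ w x x = 0 := by simp [wallDist]

lemma wallDist_comm (x y : M) : wallDist φ w x y = wallDist φ w y x := by
  simp [wallDist, eq_comm]

lemma wallDist_triangle (hw : ∀ i, 0 < w i) (x y z : M) :
    wallDist φ w x z ≤ wallDist φ w x y + wallDist φ w y z := by
  simp only [wallDist, ← Finset.sum_add_distrib]
  exact Finset.sum_le_sum fun i _ => wallDist_term_triangle hw x y z i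

lemma le_wallDist (hw : ∀ i, 0 < w i) {x y : M} {i : ι} (h : φ i x ≠ φ i y) :
    w i ≤ wallDist φ w x y := by
  have := Finset.single_le_sum (f := fun i => if φ i x = φ i y then 0 else w i)
    (fun j _ => by split_ifs; exacts [le_rfl, (hw j).le]) (Finset.mem_univ i)
  simpa [h, wallDist] using this

lemma wallDist_between_iff (hw : ∀ i, 0 < w i) (x y z : M) :
    wallDist φ w x z + wallDist φ w z y = wallDist φ w x y ↔
      ∀ i, φ i x = φ i y → φ i z = φ i x := by
  rw [eq_comm]
  simp only [wallDist, ← Finset.sum_add_distrib]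
  rw [Finset.sum_eq_sum_iff_of_le fun i _ => wallDist_term_triangle hw x z y i]
  refine ⟨fun h i hi => ?_, fun h i _ => ?_⟩
  · have h1 := h i (Finset.mem_univ i)
    have := hw i
    by_contra hne
    rw [if_pos hi, if_neg (Ne.symm hne), if_neg (hi ▸ hne)] at h1
    linarith
  · have := h i
    cases hx : φ i x <;> cases hy : φ i y <;> cases hz : φ i z <;> simp_all

end wallDist

/-- A finite median algebra `G` generated by at most `p` elements, with an approximate homomorphism
`F` to a coarse median space, carries a median metric making `F` a quasi-isometric embedding. -/
theorem exists_median_metric {X : Type*} [MetricSpace X] {μ : X → X → X → X} {k h₀ C : ℝ}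
    (hk : 0 ≤ k) (hh : 0 ≤ h₀) (hC : 0 ≤ C)
    (hlip : ∀ x y z x' y' z' : X,
      dist (μ x y z) (μ x' y' z') ≤ k * (dist x x' + dist y y' + dist z z') + h₀)
    {G : Type*} [Finite G] {m : G → G → G → G} (hm : IsMedianFn m) {F : G → X}
    (hF : ∀ a b c, dist (F (m a b c)) (μ (F a) (F b) (F c)) ≤ C) {p : ℕ} {g : Fin p → G}
    (hgen : ∀ φ ψ : G → Bool, IsBoolHom m φ → IsBoolHom m ψ →
      (∀ i, φ (g i) = ψ (g i)) → φ = ψ) :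
    ∃ _ : MetricSpace G,
      (∀ x y z : G,
        {w : G | dist x w + dist w y = dist x y} ∩ {w : G | dist y w + dist w z = dist y z} ∩
          {w : G | dist z w + dist w x = dist z x} = {m x y z}) ∧
      ∀ a b : G, dist a b ≤ 2 ^ p * (dist (F a) (F b) + 1) ∧
        dist (F a) (F b) ≤ (k + 2 * C + h₀) * dist a b := by
  classical
  have : Fintype G := Fintype.ofFinite G
  let Φ := {φ : G → Bool // IsBoolHom m φ}
  have hcard : Fintype.card Φ ≤ 2 ^ p := by
    have := Fintype.card_le_of_injective (fun (φ : Φ) (i : Fin p) => φ.1 (g i))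
      (fun φ ψ h => Subtype.ext (hgen _ _ φ.2 ψ.2 fun i => congrFun h i))
    simpa using this
  have hweight : ∀ φ : Φ, ∃ r : ℝ, 1 ≤ r ∧
      (∀ x y, φ.1 x ≠ φ.1 y → r ≤ dist (F x) (F y) + 1) ∧
      ∀ x y, φ.1 x ≠ φ.1 y → ∃ u v, φ.1 u ≠ φ.1 v ∧ r = dist (F u) (F v) + 1 := by
    intro φ
    by_cases hne : ∃ q : G × G, φ.1 q.1 ≠ φ.1 q.2
    · obtain ⟨q, hq, hmin⟩ := Set.exists_min_image {q : G × G | φ.1 q.1 ≠ φ.1 q.2}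
        (fun q => dist (F q.1) (F q.2)) (Set.toFinite _) hne
      refine ⟨dist (F q.1) (F q.2) + 1, by linarith [dist_nonneg (x := F q.1) (y := F q.2)],
        fun x y hxy => ?_, fun _ _ _ => ⟨q.1, q.2, hq, rfl⟩⟩
      have := hmin (x, y) hxy
      simpa using this
    · exact ⟨1, le_rfl, fun x y h => (hne ⟨(x, y), h⟩).elim,
        fun x y h => (hne ⟨(x, y), h⟩).elim⟩
  choose w hw1 hwle hwex using hweight
  have hw : ∀ φ, 0 < w φ := fun φ => zero_lt_one.trans_le (hw1 φ)
  have hsep : ∀ x y : G, (∀ φ : Φ, φ.1 x = φ.1 y) → x = y := fun x y h => by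
    by_contra hne
    obtain ⟨φ, hφ, hxy⟩ := hm.exists_separating hne
    exact hxy (h ⟨φ, hφ⟩)
  let D : G → G → ℝ := wallDist (fun φ : Φ => φ.1) w
  have hupper : ∀ (N : ℕ) (x y : G), {φ : Φ | φ.1 x ≠ φ.1 y}.ncard ≤ N →
      dist (F x) (F y) ≤ (k + 2 * C + h₀) * D x y := by
    intro N
    induction N with
    | zero =>
      intro x y hN
      have h0 := (Set.ncard_eq_zero (Set.toFinite _)).1 (Nat.le_zero.1 hN)
      obtain rfl : x = y := hsep x y fun φ => by
        by_contra h
        exact (Set.eq_empty_iff_forall_notMem.1 h0 φ) h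
      simp [D, wallDist_self]
    | succ N ih =>
      intro x y hN
      by_cases hz : ∃ z, m x y z = z ∧ z ≠ x ∧ z ≠ y
      · obtain ⟨z, hz, hzx, hzy⟩ := hz
        have hbet : ∀ φ : Φ, φ.1 x = φ.1 y → φ.1 z = φ.1 x := fun φ => φ.2.eq_of_between hz
        have hadd : D x z + D z y = D x y := (wallDist_between_iff hw x y z).2 hbet
        have hlt : ∀ a b c : G, (∀ φ : Φ, φ.1 a = φ.1 b → φ.1 c = φ.1 a) → c ≠ b →
            {φ : Φ | φ.1 a ≠ φ.1 c}.ncard < {φ : Φ | φ.1 a ≠ φ.1 b}.ncard := by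
          intro a b c habc hcb
          obtain ⟨φ, hφ, hne⟩ := hm.exists_separating hcb
          refine Set.ncard_lt_ncard ⟨fun ψ hψ hab => hψ (habc ψ hab).symm, fun hsub => ?_⟩
            (Set.toFinite _)
          have h1 : φ a = φ b → φ c = φ a := habc ⟨φ, hφ⟩
          have h2 : φ a ≠ φ b → φ a ≠ φ c := @hsub ⟨φ, hφ⟩
          clear habc hsub
          revert h1 h2 hne
          cases φ a <;> cases φ b <;> cases φ c <;> simp
        have h1 := ih x z (by have := hlt x y z hbet hzy; omega)
        have h2 := ih z y (by
          have := hlt y x z (fun φ h => (hbet φ h.symm).trans h.symm) hzx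
          have hsymm : ∀ a b : G, {φ : Φ | φ.1 a ≠ φ.1 b} = {φ : Φ | φ.1 b ≠ φ.1 a} :=
            fun a b => Set.ext fun φ => ne_comm
          rw [hsymm y z, hsymm y x] at this
          omega)
        calc dist (F x) (F y) ≤ dist (F x) (F z) + dist (F z) (F y) := dist_triangle _ _ _
          _ ≤ (k + 2 * C + h₀) * D x y := by rw [← hadd, mul_add]; exact add_le_add h1 h2
      · push Not at hz
        by_cases hxy : x = y
        · subst hxy
          simp [D, wallDist_self]
        obtain ⟨φ, hφ, hne⟩ := hm.exists_separating hxy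
        have hproj : ∀ a, m x y a = x ∨ m x y a = y := fun a => by
          by_contra! h
          refine h.2 (hz _ ?_ h.1)
          rw [← hm.rotate a x y, ← hm.rotate _ x y, hm.proj_proj]
        have hx : ∀ a, φ a = φ x → m x y a = x := fun a ha => (hproj a).resolve_right fun h => by
          apply hne
          rw [← h, hφ, ha]
          cases φ x <;> cases φ y <;> rfl
        have hy : ∀ a, φ a = φ y → m x y a = y := fun a ha => (hproj a).resolve_left fun h => by
          apply hne
          rw [← h, hφ, ha]
          cases φ x <;> cases φ y <;> rfl
        have hbound : ∀ u v, φ u = φ x → φ v = φ y →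
            dist (F x) (F y) ≤ k * dist (F u) (F v) + 2 * C + h₀ := by
          intro u v hu hv
          have h1 := hF x y u
          have h2 := hF x y v
          rw [hx u hu] at h1
          rw [hy v hv] at h2
          have h3 := hlip (F x) (F y) (F u) (F x) (F y) (F v)
          simp only [dist_self, zero_add] at h3
          have h4 := dist_triangle4 (F x) (μ (F x) (F y) (F u)) (μ (F x) (F y) (F v)) (F y)
          rw [dist_comm (F y)] at h2
          linarith
        obtain ⟨u, v, huv, hr⟩ := hwex ⟨φ, hφ⟩ x y hne
        have hb : dist (F x) (F y) ≤ k * dist (F u) (F v) + 2 * C + h₀ := by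
          have hcases : (φ u = φ x ∧ φ v = φ y) ∨ (φ v = φ x ∧ φ u = φ y) := by
            clear hx hy hbound
            revert huv hne
            dsimp only
            cases φ x <;> cases φ y <;> cases φ u <;> cases φ v <;> simp
          rcases hcases with h | h
          · exact hbound u v h.1 h.2
          · rw [dist_comm (F u)]
            exact hbound v u h.1 h.2
        have hD : dist (F u) (F v) + 1 ≤ D x y := hr ▸ le_wallDist (i := (⟨φ, hφ⟩ : Φ)) hw hne
        have hd := dist_nonneg (x := F u) (y := F v)
        calc dist (F x) (F y) ≤ k * dist (F u) (F v) + 2 * C + h₀ := hb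
          _ ≤ (k + 2 * C + h₀) * (dist (F u) (F v) + 1) := by
            nlinarith [mul_nonneg hC hd, mul_nonneg hh hd]
          _ ≤ (k + 2 * C + h₀) * D x y := by gcongr
  let I : MetricSpace G :=
    { dist := D
      dist_self := wallDist_self
      dist_comm := wallDist_comm
      dist_triangle := wallDist_triangle hw
      eq_of_dist_eq_zero := fun {x y} h => hsep x y fun φ => by
        by_contra hne
        exact absurd h ((hw φ).trans_le (le_wallDist (φ := fun φ : Φ => φ.1) hw hne)).ne' }
  refine ⟨I, fun x y z => ?_, fun a b => ⟨?_, hupper _ a b le_rfl⟩⟩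
  · have hI : ∀ a b c : G, dist a c + dist c b = dist a b ↔
        ∀ φ : Φ, φ.1 a = φ.1 b → φ.1 c = φ.1 a := fun a b c => wallDist_between_iff hw a b c
    ext c
    simp only [Set.mem_inter_iff, Set.mem_ofPred_eq, Set.mem_singleton_iff, hI]
    constructor
    · rintro ⟨⟨h1, h2⟩, h3⟩
      refine hsep _ _ fun φ => ?_
      rw [φ.2]
      have h1 := h1 φ
      have h2 := h2 φ
      have h3 := h3 φ
      clear hI
      revert h1 h2 h3
      cases φ.1 x <;> cases φ.1 y <;> cases φ.1 z <;> simp [boolMaj]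
    · rintro rfl
      refine ⟨⟨?_, ?_⟩, ?_⟩ <;> intro φ <;> rw [φ.2] <;>
        cases φ.1 x <;> cases φ.1 y <;> cases φ.1 z <;> simp [boolMaj]
  · have hd := dist_nonneg (x := F a) (y := F b)
    calc D a b ≤ ∑ _φ : Φ, (dist (F a) (F b) + 1) := by
          refine Finset.sum_le_sum fun φ _ => ?_
          split_ifs with h
          · positivity
          · exact hwle φ a b h
      _ = Fintype.card Φ * (dist (F a) (F b) + 1) := by simp [Finset.card_univ, mul_add]
      _ ≤ 2 ^ p * (dist (F a) (F b) + 1) := by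
          gcongr
          exact_mod_cast hcard

/-- The median of a linear order. -/
def chainMedian {L : Type*} [LinearOrder L] (x y z : L) : L :=
  max (max (min x y) (min y z)) (min z x)

lemma isMedianFn_chainMedian (L : Type*) [LinearOrder L] :
    IsMedianFn (chainMedian : L → L → L → L) := by
  refine ⟨fun x y z => ?_, fun x y z => ?_, fun x y => ?_, fun x y z u v => ?_⟩ <;>
    refine eq_of_forall_le_iff fun t => ?_ <;>
    simp only [chainMedian, le_max_iff, le_min_iff] <;> tauto

/-- The componentwise median on a product. -/
def prodMedian {M N : Type*} (m : M → M → M → M) (m' : N → N → N → N) (x y z : M × N) : M × N :=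
  (m x.1 y.1 z.1, m' x.2 y.2 z.2)

lemma IsMedianFn.prod {M N : Type*} {m : M → M → M → M} {m' : N → N → N → N}
    (hm : IsMedianFn m) (hm' : IsMedianFn m') : IsMedianFn (prodMedian m m') :=
  ⟨fun _ _ _ => Prod.ext (hm.1 _ _ _) (hm'.1 _ _ _),
    fun _ _ _ => Prod.ext (hm.2.1 _ _ _) (hm'.2.1 _ _ _),
    fun _ _ => Prod.ext (hm.2.2.1 _ _) (hm'.2.2.1 _ _),
    fun _ _ _ _ _ => Prod.ext (hm.2.2.2 _ _ _ _ _) (hm'.2.2.2 _ _ _ _ _)⟩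

lemma chainMedian_square {L : Type*} [LinearOrder L] {a b c d : L} (ha : chainMedian a b c = a)
    (hb : chainMedian a b d = b) (hc : chainMedian a c d = c) :
    a = b ∨ a = c := by
  grind [chainMedian]

/-- A homomorphism from a cube to a chain is constant on all edges at the origin but one. -/
lemma exists_direction_of_chain {L : Type*} [LinearOrder L] {d : ℕ} {f : (Fin (d + 1) → Bool) → L}
    (hf : ∀ x y z, f (cubeMedian (d + 1) x y z) = chainMedian (f x) (f y) (f z)) :
    ∃ i₀, ∀ j ≠ i₀, f (fun _ => false) = f (Pi.single j true) := by
  by_contra! hcon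
  obtain ⟨i, -, hi⟩ := hcon 0
  obtain ⟨j, hji, hj⟩ := hcon i
  have h1 := hf (fun _ => false) (Pi.single i true) (Pi.single j true)
  have h2 := hf (fun _ => false) (Pi.single i true) (fun t => t = i || t = j)
  have h3 := hf (fun _ => false) (Pi.single j true) (fun t => t = i || t = j)
  have h0 : (0 : Bool) = false := rfl
  have e1 : cubeMedian (d + 1) (fun _ => false) (Pi.single i true) (Pi.single j true) =
      fun _ => false := by
    funext t
    by_cases hti : t = i <;> by_cases htj : t = j <;> simp [cubeMedian, h0, hti, htj, hji, hji.symm]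
  have e2 : cubeMedian (d + 1) (fun _ => false) (Pi.single i true) (fun t => t = i || t = j) =
      Pi.single i true := by
    funext t
    by_cases hti : t = i <;> by_cases htj : t = j <;> simp [cubeMedian, h0, hti, htj, hji, hji.symm]
  have e3 : cubeMedian (d + 1) (fun _ => false) (Pi.single j true) (fun t => t = i || t = j) =
      Pi.single j true := by
    funext t
    by_cases hti : t = i <;> by_cases htj : t = j <;> simp [cubeMedian, h0, hti, htj, hji, hji.symm]
  rw [e1] at h1
  rw [e2] at h2
  rw [e3] at h3
  rcases chainMedian_square h1.symm h2.symm h3.symm with h | h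
  exacts [hi h, hj h]

/-- Multiplying a median algebra with a chain increases its rank by at most one. -/
lemma RankLE.prod_chain {M L : Type*} [LinearOrder L] {m : M → M → M → M} {n : ℕ}
    (hr : RankLE m n) :
    RankLE (prodMedian m (chainMedian : L → L → L → L)) (n + 1) := by
  rintro ⟨f, hinj, hf⟩
  obtain ⟨i₀, hi₀⟩ := exists_direction_of_chain (f := fun x => (f x).2)
    (fun x y z => by rw [hf]; rfl)
  refine hr ⟨fun x => (f (i₀.insertNth false x)).1, fun x y hxy => ?_, fun x y z => ?_⟩
  · funext s
    by_contra hne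
    have hproj : ∀ x : Fin (n + 1) → Bool,
        cubeMedian (n + 1 + 1) (fun _ => false) (Pi.single (i₀.succAbove s) true)
          (i₀.insertNth false x) =
        if x s then Pi.single (i₀.succAbove s) true else fun _ => false := by
      intro x
      funext t
      by_cases ht : t = i₀.succAbove s
      · subst ht
        cases hx : x s <;> simp [cubeMedian, hx]
      · cases hx : x s <;> simp [cubeMedian, ht]
    have hval : ∀ x : Fin (n + 1) → Bool,
        (f (if x s then Pi.single (i₀.succAbove s) true else fun _ => false)).1 =
        m (f fun _ => false).1 (f (Pi.single (i₀.succAbove s) true)).1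
          (f (i₀.insertNth false x)).1 := by
      intro x
      rw [← hproj, hf]
      rfl
    have h1 := hval x
    have h2 := hval y
    rw [show (f (i₀.insertNth false x)).1 = (f (i₀.insertNth false y)).1 from hxy, ← h2] at h1
    have h3 := hi₀ _ (i₀.succAbove_ne s)
    have h4 : f (fun _ => false) = f (Pi.single (i₀.succAbove s) true) := by
      refine Prod.ext ?_ h3
      clear hproj hval h2 h3 hi₀ hf hxy
      revert hne h1
      cases x s <;> cases y s <;> simp [eq_comm]
    have h5 := congrFun (hinj h4) (i₀.succAbove s)
    simp at h5
  · have : i₀.insertNth false (cubeMedian (n + 1) x y z) =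
        cubeMedian (n + 1 + 1) (i₀.insertNth false x) (i₀.insertNth false y)
          (i₀.insertNth (α := fun _ => Bool) false z) := by
      funext t
      refine Fin.succAboveCases i₀ ?_ (fun s => ?_) t <;> simp [cubeMedian]
    dsimp only
    rw [this, hf]
    rfl

/-- Membership in the subalgebra generated by a set. -/
inductive MedianClosure {M : Type*} (m : M → M → M → M) (S : Set M) : M → Prop
  | base {x : M} : x ∈ S → MedianClosure m S x
  | median {x y z : M} : MedianClosure m S x → MedianClosure m S y → MedianClosure m S z →
      MedianClosure m S (m x y z)

/-- The median operation of the subalgebra generated by a set. -/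
def closureMedian {M : Type*} (m : M → M → M → M) (S : Set M)
    (x y z : {x // MedianClosure m S x}) : {x // MedianClosure m S x} :=
  ⟨m x y z, x.2.median y.2 z.2⟩

lemma IsMedianFn.closure {M : Type*} {m : M → M → M → M} (hm : IsMedianFn m) (S : Set M) :
    IsMedianFn (closureMedian m S) :=
  ⟨fun _ _ _ => Subtype.ext (hm.1 _ _ _), fun _ _ _ => Subtype.ext (hm.2.1 _ _ _),
    fun _ _ => Subtype.ext (hm.2.2.1 _ _), fun _ _ _ _ _ => Subtype.ext (hm.2.2.2 _ _ _ _ _)⟩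

lemma RankLE.closure {M : Type*} {m : M → M → M → M} {n : ℕ} (hr : RankLE m n) (S : Set M) :
    RankLE (closureMedian m S) n := by
  rintro ⟨f, hinj, hf⟩
  exact hr ⟨fun x => (f x).1, Subtype.val_injective.comp hinj,
    fun x y z => congrArg Subtype.val (hf x y z)⟩

lemma IsBoolHom.eq_of_eqOn_generators {M : Type*} {m : M → M → M → M} {S : Set M}
    {φ ψ : {x // MedianClosure m S x} → Bool} (hφ : IsBoolHom (closureMedian m S) φ)
    (hψ : IsBoolHom (closureMedian m S) ψ)
    (h : ∀ x (hx : x ∈ S), φ ⟨x, .base hx⟩ = ψ ⟨x, .base hx⟩) : φ = ψ := by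
  funext ⟨x, hx⟩
  induction hx with
  | base hx => exact h _ hx
  | median hx hy hz ihx ihy ihz =>
    have h1 := hφ ⟨_, hx⟩ ⟨_, hy⟩ ⟨_, hz⟩
    have h2 := hψ ⟨_, hx⟩ ⟨_, hy⟩ ⟨_, hz⟩
    rw [ihx, ihy, ihz, ← h2] at h1
    exact h1

/-- The defect of the approximate homomorphism built from an approximation with error `δ`. -/
def homDefect (k h₀ δ : ℝ) : ℝ := 2 * δ + 3 * k * δ + h₀

/-- The multiplicative constant for an approximation of `p` points with error `δ`. -/
noncomputable def embeddingConst (k h₀ δ : ℝ) (p : ℕ) : ℝ :=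
  2 ^ p + |k + 2 * homDefect k h₀ δ + h₀|

/-- An approximation of a finite set in a coarse median space by a finite median algebra gives a
quasi-isometrically embedded finite median metric space of rank larger by at most one, whose
image contains the set. -/
theorem exists_median_embedding {X : Type*} [MetricSpace X] {μ : X → X → X → X} {k h₀ δ : ℝ}
    (hk : 0 ≤ k) (hh : 0 ≤ h₀) (hδ : 0 ≤ δ)
    (hlip : ∀ x y z x' y' z' : X,
      dist (μ x y z) (μ x' y' z') ≤ k * (dist x x' + dist y y' + dist z z') + h₀)
    (A : Finset X) {M₀ : Type} [Finite M₀] {m : M₀ → M₀ → M₀ → M₀} (hm : IsMedianFn m)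
    {lam : M₀ → X} {proj : X → M₀} (hproj : ∀ a ∈ A, dist a (lam (proj a)) ≤ δ)
    (hlam : ∀ m₁ m₂ m₃, dist (lam (m m₁ m₂ m₃)) (μ (lam m₁) (lam m₂) (lam m₃)) ≤ δ) :
    ∃ (M : Type) (_ : MetricSpace M) (_ : Fintype M) (μM : M → M → M → M) (F : M → X),
      (∀ x y z : M,
        {w : M | dist x w + dist w y = dist x y} ∩ {w : M | dist y w + dist w z = dist y z} ∩
          {w : M | dist z w + dist w x = dist z x} = {μM x y z}) ∧
      (∀ n, RankLE m n → RankLE μM (n + 1)) ∧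
      (∀ a b : M, (embeddingConst k h₀ δ A.card)⁻¹ * dist a b - 1 ≤ dist (F a) (F b) ∧
        dist (F a) (F b) ≤ embeddingConst k h₀ δ A.card * dist a b + 1) ∧
      ↑A ⊆ Set.range F := by
  classical
  let pt : Fin A.card → X := fun i => (A.equivFin.symm i : X)
  have hpt : ∀ i, pt i ∈ A := fun i => (A.equivFin.symm i).2
  let gen : Fin A.card → M₀ × Fin A.card := fun i => (proj (pt i), i)
  let F₀ : M₀ × Fin A.card → X := fun q => if q = gen q.2 then pt q.2 else lam q.1
  have hF₀ : ∀ q, dist (F₀ q) (lam q.1) ≤ δ := fun q => by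
    by_cases hq : q = gen q.2
    · have h1 : q.1 = proj (pt q.2) := congrArg Prod.fst hq
      simp only [F₀, if_pos hq]
      rw [h1]
      exact hproj _ (hpt _)
    · simpa only [F₀, if_neg hq, dist_self] using hδ
  let mP := prodMedian m (chainMedian : Fin A.card → Fin A.card → Fin A.card → Fin A.card)
  have hmP : IsMedianFn mP := hm.prod (isMedianFn_chainMedian _)
  have hdef : ∀ a b c, dist (F₀ (mP a b c)) (μ (F₀ a) (F₀ b) (F₀ c)) ≤ homDefect k h₀ δ := by
    intro a b c
    have h1 := dist_triangle4 (F₀ (mP a b c)) (lam (mP a b c).1)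
      (μ (lam a.1) (lam b.1) (lam c.1)) (μ (F₀ a) (F₀ b) (F₀ c))
    have h2 := hlip (lam a.1) (lam b.1) (lam c.1) (F₀ a) (F₀ b) (F₀ c)
    rw [dist_comm (lam a.1), dist_comm (lam b.1), dist_comm (lam c.1)] at h2
    have h3 : k * (dist (F₀ a) (lam a.1) + dist (F₀ b) (lam b.1) + dist (F₀ c) (lam c.1)) ≤
        k * (δ + δ + δ) := by
      gcongr <;> apply hF₀
    have h4 := hF₀ (mP a b c)
    have h5 : dist (lam (mP a b c).1) (μ (lam a.1) (lam b.1) (lam c.1)) ≤ δ := hlam _ _ _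
    unfold homDefect
    linarith
  let S := Set.range gen
  let G := {x // MedianClosure mP S x}
  have hC : 0 ≤ homDefect k h₀ δ := by unfold homDefect; positivity
  obtain ⟨I, hI, hQ⟩ := exists_median_metric hk hh hC hlip (hmP.closure S)
    (F := fun x : G => F₀ x.1) (fun a b c => hdef a.1 b.1 c.1)
    (g := fun i => (⟨gen i, .base ⟨i, rfl⟩⟩ : G))
    (fun φ ψ hφ hψ h => hφ.eq_of_eqOn_generators hψ (by rintro _ ⟨i, rfl⟩; exact h i))
  refine ⟨G, I, Fintype.ofFinite G, closureMedian mP S, fun x => F₀ x.1, hI,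
    fun n hn => hn.prod_chain.closure S, fun a b => ?_, fun a ha => ?_⟩
  · obtain ⟨h1, h2⟩ := hQ a b
    have hpos : (0 : ℝ) < 2 ^ A.card := by positivity
    have habs := abs_nonneg (k + 2 * homDefect k h₀ δ + h₀)
    have hle := le_abs_self (k + 2 * homDefect k h₀ δ + h₀)
    have hα : 0 < embeddingConst k h₀ δ A.card := by unfold embeddingConst; linarith
    have hd := dist_nonneg (x := F₀ a.1) (y := F₀ b.1)
    constructor
    · rw [sub_le_iff_le_add, inv_mul_le_iff₀ hα]
      refine h1.trans ?_
      gcongr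
      unfold embeddingConst
      linarith
    · refine h2.trans ?_
      have : (k + 2 * homDefect k h₀ δ + h₀) * dist a b ≤
          embeddingConst k h₀ δ A.card * dist a b := by
        gcongr
        unfold embeddingConst
        linarith
      linarith
  · have hpa : pt (A.equivFin ⟨a, ha⟩) = a := by simp [pt]
    refine ⟨⟨gen (A.equivFin ⟨a, ha⟩), .base ⟨_, rfl⟩⟩, ?_⟩
    simp only [F₀, gen, if_true]
    exact hpa

/-- For every `k`, every non-decreasing `h : ℕ → ℝ≥0` and every `n ∈ ℕ`
there are functions `α, ε : ℕ → ℝ≥0` (depending only on `k, h, n`) such that for every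
metric space `X` with a coarse median `μ` with parameters `(k, h)` and every finite subset
`A ⊆ X` there exist a finite median metric space `(M, d_M)` (with intrinsic median
operation `μM`: the intersection of the three metric intervals of any triple is the
singleton on `μM`) and an `(α(|A|), ε(|A|))`-quasi-isometric embedding `F : M → X` with
`A ⊆ F(M)`; moreover if `μ` has rank at most `n` with parameters `(k, h)`, then `M` can
always be chosen so that its intrinsic median algebra has rank at most `n + 1`. -/
theorem stmt_19 (k : ℝ) (h : ℕ → ℝ) (n : ℕ) :
    ∃ α ε : ℕ → ℝ, (∀ j, 0 < α j ∧ 0 ≤ ε j) ∧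
      (∀ (X : Type u) [MetricSpace X] (μ : X → X → X → X), IsCoarseMedianWith μ k h →
        ∀ A : Finset X,
          ∃ (M : Type) (_ : MetricSpace M) (_ : Fintype M)
            (μM : M → M → M → M) (F : M → X),
            (∀ x y z : M,
              {w : M | dist x w + dist w y = dist x y} ∩
                  {w : M | dist y w + dist w z = dist y z} ∩
                  {w : M | dist z w + dist w x = dist z x} = {μM x y z}) ∧
            (∀ a b : M, (α A.card)⁻¹ * dist a b - ε A.card ≤ dist (F a) (F b) ∧
              dist (F a) (F b) ≤ α A.card * dist a b + ε A.card) ∧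
            ↑A ⊆ Set.range F) ∧
      ∀ (X : Type u) [MetricSpace X] (μ : X → X → X → X), IsCoarseMedianWithRank μ k h n →
        ∀ A : Finset X,
          ∃ (M : Type) (_ : MetricSpace M) (_ : Fintype M)
            (μM : M → M → M → M) (F : M → X),
            (∀ x y z : M,
              {w : M | dist x w + dist w y = dist x y} ∩
                  {w : M | dist y w + dist w z = dist y z} ∩
                  {w : M | dist z w + dist w x = dist z x} = {μM x y z}) ∧
            RankLE μM (n + 1) ∧
            (∀ a b : M, (α A.card)⁻¹ * dist a b - ε A.card ≤ dist (F a) (F b) ∧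
              dist (F a) (F b) ≤ α A.card * dist a b + ε A.card) ∧
            ↑A ⊆ Set.range F := by
  refine ⟨fun j => embeddingConst k (h 0) (h j) j, fun _ => 1, fun j => ⟨?_, zero_le_one⟩, ?_, ?_⟩
  · have := abs_nonneg (k + 2 * homDefect k (h 0) (h j) + h 0)
    unfold embeddingConst
    positivity
  · rintro X _ μ ⟨hk, hh, -, hlip, happ⟩ A
    rcases A.eq_empty_or_nonempty with rfl | hA
    · exact ⟨Empty, inferInstance, inferInstance, fun x _ _ => x, Empty.elim, fun x => x.elim,
        fun x => x.elim, by simp⟩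
    · obtain ⟨M₀, _, m, lam, proj, hm, hproj, hlam⟩ := happ A hA
      obtain ⟨M, I, I', μM, F, h1, -, h2⟩ :=
        exists_median_embedding hk (hh 0) (hh _) hlip A hm hproj hlam
      exact ⟨M, I, I', μM, F, h1, h2⟩
  · rintro X _ μ ⟨hk, hh, -, hlip, happ⟩ A
    rcases A.eq_empty_or_nonempty with rfl | hA
    · exact ⟨Empty, inferInstance, inferInstance, fun x _ _ => x, Empty.elim, fun x => x.elim,
        fun ⟨f, _⟩ => (f fun _ => false).elim, fun x => x.elim, by simp⟩
    · obtain ⟨M₀, _, m, lam, proj, hm, hr, hproj, hlam⟩ := happ A hA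
      obtain ⟨M, I, I', μM, F, h1, hr', h2⟩ :=
        exists_median_embedding hk (hh 0) (hh _) hlip A hm hproj hlam
      exact ⟨M, I, I', μM, F, h1, hr' n hr, h2⟩
end
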